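/- Let R be a commutative noetherian local ring, I a proper ideal of R such that S := R/I has finite projective dimension over R. If the conormal module I/I² has finite projective dimension as an S-module, then I is generated by a regular sequence (Vasconcelos' conjecture). -/

import Mathlib

/-!
Vasconcelos' conjecture (Briggs): if `I` is a proper ideal of a commutative noetherian
local ring `R` such that `S := R ⧸ I` has finite projective dimension over `R`, and the
conormal module `I/I² = I.Cotangent` has finite projective dimension over `S`, then `I`
is generated by a regular sequence.

Projective dimension `≤ n` of a module is expressed by the existence of a projective
resolution (a bounded-below complex of projectives quasi-isomorphic to the module)
vanishing in degrees `> n`.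
-/

open CategoryTheory Limits

universe u

noncomputable section

/-- `M` has projective dimension at most `n` over `R`. -/
def ModuleCat.HasProjDimLE (R : Type u) [CommRing R] (M : ModuleCat.{u} R) (n : ℕ) : Prop :=
  ∃ (P : ChainComplex (ModuleCat.{u} R) ℕ)
    (π : P ⟶ (ChainComplex.single₀ (ModuleCat.{u} R)).obj M),
    QuasiIso π ∧ (∀ i, Projective (P.X i)) ∧ ∀ i, n < i → IsZero (P.X i)

open TensorProduct

namespace Vasconcelos

section Core

variable {R : Type*} [CommRing R] {I : Ideal R}

/-- A module with `I`-adically filtered graded pieces and a differential squaring to zero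
modulo `I`. -/
structure Sys (I : Ideal R) (Z : Type*) [AddCommGroup Z] [Module R Z] where
  F : ℕ → ℤ → Submodule R Z
  le : ∀ j n, F (j + 1) n ≤ F j n
  smul : ∀ j n a x, a ∈ I → x ∈ F j n → a • x ∈ F (j + 1) n
  δ : Z →ₗ[R] Z
  δ_mem : ∀ j n x, x ∈ F j n → δ x ∈ F j (n - 1)
  δδ : ∀ n x, x ∈ F 0 n → δ (δ x) ∈ F 1 (n - 2)

/-- A finite graded free module with a degree `-1` matrix squaring to zero modulo `I`. -/
structure Cx (I : Ideal R) where
  Γ : Type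
  [fin : Fintype Γ]
  [dec : DecidableEq Γ]
  deg : Γ → ℕ
  A : Γ → Γ → R
  deg_eq : ∀ c c', A c c' ≠ 0 → deg c' = deg c + 1
  sq : ∀ c c'', ∑ c', A c c' * A c' c'' ∈ I

attribute [instance] Cx.fin Cx.dec

section Act

variable {Γ Γ' Γ'' Z Z' : Type*} [Fintype Γ] [AddCommGroup Z] [Module R Z]
  [AddCommGroup Z'] [Module R Z']

/-- The action of a matrix on vectors with entries in a module. -/
def act (A : Γ' → Γ → R) : (Γ → Z) →ₗ[R] (Γ' → Z) where
  toFun x c := ∑ c', A c c' • x c'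
  map_add' x y := by ext c; simp [Finset.sum_add_distrib]
  map_smul' r x := by ext c; simp [Finset.smul_sum, smul_comm r]

theorem act_apply (A : Γ' → Γ → R) (x : Γ → Z) (c : Γ') : act A x c = ∑ c', A c c' • x c' := rfl

theorem act_act [Fintype Γ'] (A : Γ'' → Γ' → R) (B : Γ' → Γ → R) (x : Γ → Z) :
    act A (act B x) = act (fun c c'' => ∑ c', A c c' * B c' c'') x := by
  ext c
  simp only [act_apply, Finset.smul_sum, Finset.sum_smul, smul_smul]
  rw [Finset.sum_comm]

theorem act_map (A : Γ' → Γ → R) (g : Z →ₗ[R] Z') (x : Γ → Z) (c : Γ') :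
    act A (fun c => g (x c)) c = g (act A x c) := by
  simp [act_apply]

end Act

variable {Z : Type*} [AddCommGroup Z] [Module R Z]

namespace Sys

variable (Y : Sys I Z)

theorem cast {j : ℕ} {m n : ℤ} {x : Z} (h : x ∈ Y.F j m) (e : m = n) : x ∈ Y.F j n := e ▸ h

/-- Boundaries modulo `I`. -/
def Bd (n : ℤ) (x : Z) : Prop := ∃ z ∈ Y.F 0 (n + 1), x - Y.δ z ∈ Y.F 1 n

/-- Cycles modulo `I`. -/
def Cyc (n : ℤ) (x : Z) : Prop := x ∈ Y.F 0 n ∧ Y.δ x ∈ Y.F 1 (n - 1)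

variable {Y}

theorem Bd.add {n : ℤ} {x y : Z} (hx : Y.Bd n x) (hy : Y.Bd n y) : Y.Bd n (x + y) := by
  obtain ⟨z, hz, h⟩ := hx
  obtain ⟨w, hw, h'⟩ := hy
  refine ⟨z + w, add_mem hz hw, ?_⟩
  convert add_mem h h' using 1
  rw [map_add]; abel

theorem Bd.neg {n : ℤ} {x : Z} (hx : Y.Bd n x) : Y.Bd n (-x) := by
  obtain ⟨z, hz, h⟩ := hx
  refine ⟨-z, neg_mem hz, ?_⟩
  convert neg_mem h using 1
  rw [map_neg]; abel

theorem Bd.of_eq {n : ℤ} {x y : Z} (hx : Y.Bd n x) (e : x = y) : Y.Bd n y := e ▸ hx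

theorem Bd.of_mem {n : ℤ} {x : Z} (hx : x ∈ Y.F 1 n) : Y.Bd n x :=
  ⟨0, zero_mem _, by simpa using hx⟩

end Sys

namespace Cx

variable (N : Cx I) (Y : Sys I Z)

theorem act_mem {j : ℕ} {n : ℤ} {x : N.Γ → Z} (hx : ∀ c, x c ∈ Y.F j (n - N.deg c)) (c : N.Γ) :
    act N.A x c ∈ Y.F j (n - 1 - N.deg c) := by
  refine sum_mem fun c' _ => ?_
  by_cases h : N.A c c' = 0
  · simp [h]
  · refine Submodule.smul_mem _ _ (Y.cast (hx c') ?_)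
    rw [N.deg_eq _ _ h]; push_cast; ring

/-- Multiplication of each coordinate by a sign. -/
def diff : (N.Γ → Z) →ₗ[R] (N.Γ → Z) where
  toFun x c := act N.A x c + (-1 : R) ^ N.deg c • Y.δ (x c)
  map_add' x y := by ext c; simp only [map_add, Pi.add_apply, smul_add]; abel
  map_smul' r x := by ext c; simp [smul_comm r]

theorem diff_apply (x : N.Γ → Z) (c : N.Γ) :
    N.diff Y x c = act N.A x c + (-1 : R) ^ N.deg c • Y.δ (x c) := rfl

theorem diff_diff (x : N.Γ → Z) (c : N.Γ) : N.diff Y (N.diff Y x) c =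
    act (fun c c'' => ∑ c', N.A c c' * N.A c' c'') x c + Y.δ (Y.δ (x c)) := by
  have h1 : N.diff Y x = act N.A x + fun c => (-1 : R) ^ N.deg c • Y.δ (x c) := rfl
  rw [diff_apply, h1, map_add, act_act]
  simp only [Pi.add_apply, map_add, map_smul, smul_add, smul_smul, ← pow_add,
    Even.neg_one_pow ⟨_, rfl⟩, one_smul, ← act_map]
  have h2 : act N.A (fun c => (-1 : R) ^ N.deg c • Y.δ (x c)) c =
      - ((-1 : R) ^ N.deg c • act N.A (fun c => Y.δ (x c)) c) := by
    simp only [act_apply, Finset.smul_sum, ← Finset.sum_neg_distrib]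
    refine Finset.sum_congr rfl fun c' _ => ?_
    by_cases h : N.A c c' = 0
    · simp [h]
    · rw [N.deg_eq _ _ h, pow_succ, smul_comm]; simp
  rw [h2]; abel

/-- The tensor product of a free complex with a system. -/
def tensor : Sys I (N.Γ → Z) where
  F j n := Submodule.pi Set.univ fun c => Y.F j (n - N.deg c)
  le j n := Submodule.pi_mono fun c _ => Y.le _ _
  smul j n a x ha hx := by
    simp only [Submodule.mem_pi, Set.mem_univ, forall_const] at *
    exact fun c => Y.smul _ _ _ _ ha (hx c)
  δ := N.diff Y
  δ_mem j n x hx := by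
    simp only [Submodule.mem_pi, Set.mem_univ, forall_const] at *
    refine fun c => add_mem (N.act_mem Y hx c) (Submodule.smul_mem _ _ ?_)
    exact Y.cast (Y.δ_mem _ _ _ (hx c)) (by ring)
  δδ n x hx := by
    simp only [Submodule.mem_pi, Set.mem_univ, forall_const] at *
    intro c
    rw [diff_diff]
    refine add_mem (sum_mem fun c' _ => ?_) (Y.cast (Y.δδ _ _ (hx c)) (by ring))
    by_cases h : N.deg c' = N.deg c + 2
    · exact Y.cast (Y.smul _ _ _ _ (N.sq c c') (hx c')) (by rw [h]; push_cast; ring)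
    · beta_reduce
      rw [Finset.sum_eq_zero, zero_smul]
      · exact zero_mem _
      · intro d _
        by_contra h'
        have h1 := N.deg_eq _ _ (left_ne_zero_of_mul h')
        have h2 := N.deg_eq _ _ (right_ne_zero_of_mul h')
        omega

variable {N Y}

theorem mem_tensor {j : ℕ} {n : ℤ} {x : N.Γ → Z} :
    x ∈ (N.tensor Y).F j n ↔ ∀ c, x c ∈ Y.F j (n - N.deg c) := by
  simp [tensor, Submodule.mem_pi]

theorem tensor_δ (x : N.Γ → Z) : (N.tensor Y).δ x = N.diff Y x := rfl

variable (N)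

/-- The dual of a finite free complex. -/
def dual : Sys I (N.Γ → R) where
  F j n := Submodule.pi Set.univ fun c => if n = - (N.deg c : ℤ) then I ^ j else ⊥
  le j n := Submodule.pi_mono fun c _ => by
    split_ifs
    · exact Ideal.pow_le_pow_right (by omega)
    · exact le_rfl
  smul j n a x ha hx := by
    simp only [Submodule.mem_pi, Set.mem_univ, forall_const] at *
    intro c
    have := hx c
    split_ifs at * with h
    · rw [pow_succ']; exact Ideal.mul_mem_mul ha this
    · simp at this; simp [this]
  δ :=
  { toFun Y c := - ∑ c', (-1) ^ N.deg c' * Y c' * N.A c' c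
    map_add' x y := by
      ext c; simp [mul_add, add_mul, Finset.sum_add_distrib]; abel
    map_smul' r x := by
      ext c; simp only [Pi.smul_apply, smul_eq_mul, RingHom.id_apply, mul_neg, Finset.mul_sum]
      congr 1; refine Finset.sum_congr rfl fun _ _ => by ring }
  δ_mem j n x hx := by
    simp only [Submodule.mem_pi, Set.mem_univ, forall_const, LinearMap.coe_mk, AddHom.coe_mk] at *
    refine fun c => neg_mem (sum_mem fun c' _ => ?_)
    have hc := hx c'
    by_cases h : N.A c' c = 0
    · simp [h]
    · have hd := N.deg_eq _ _ h
      split_ifs at * with h1 h2 h2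
      · exact Ideal.mul_mem_right _ _ (Ideal.mul_mem_left _ _ hc)
      · omega
      · omega
      · simp_all
  δδ n x hx := by
    simp only [Submodule.mem_pi, Set.mem_univ, forall_const, LinearMap.coe_mk, AddHom.coe_mk] at *
    intro c
    have key : (- ∑ c', (-1) ^ N.deg c' * (- ∑ c'', (-1) ^ N.deg c'' * x c'' * N.A c'' c') *
        N.A c' c) = - ∑ c'', x c'' * ∑ c', N.A c'' c' * N.A c' c := by
      simp only [Finset.mul_sum, Finset.sum_mul, mul_neg, neg_mul, ← Finset.sum_neg_distrib]
      rw [Finset.sum_comm]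
      refine Finset.sum_congr rfl fun a _ => Finset.sum_congr rfl fun b _ => ?_
      by_cases h : N.A a b = 0
      · simp [h]
      · rw [N.deg_eq _ _ h]
        have : ((-1 : R) ^ N.deg a) * (-1) ^ N.deg a = 1 := by
          rw [← pow_add]; exact Even.neg_one_pow ⟨_, rfl⟩
        linear_combination (- x a * N.A a b * N.A b c) * this
    rw [key]
    refine neg_mem (sum_mem fun c' _ => ?_)
    by_cases h : N.deg c = N.deg c' + 2
    · have := hx c'
      split_ifs at * with h1 h2 h2
      · simpa using Ideal.mul_mem_left _ _ (N.sq c' c)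
      · omega
      · omega
      · simp_all
    · rw [Finset.sum_eq_zero, mul_zero]
      · exact zero_mem _
      · intro d _
        by_contra h'
        have h1 := N.deg_eq _ _ (left_ne_zero_of_mul h')
        have h2 := N.deg_eq _ _ (right_ne_zero_of_mul h')
        omega

theorem mem_dual {j : ℕ} {n : ℤ} {x : N.Γ → R} :
    x ∈ N.dual.F j n ↔ ∀ c, x c ∈ if n = - (N.deg c : ℤ) then I ^ j else ⊥ := by
  simp [dual, Submodule.mem_pi]

theorem dual_δ (x : N.Γ → R) (c : N.Γ) :
    N.dual.δ x c = - ∑ c', (-1) ^ N.deg c' * x c' * N.A c' c := rfl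

end Cx

end Core

section Core

variable {R : Type*} [CommRing R] {I m : Ideal R}

/-- A lift to `R` of a finite free resolution over `R ⧸ I`, augmented by elements `φ`, with a
distinguished cell `e` in degree zero. -/
structure Res (I m : Ideal R) extends Cx I where
  φ : Γ → R
  φ_deg : ∀ a, φ a ≠ 0 → deg a = 0
  e : Γ
  deg_e : deg e = 0
  A_e : ∀ b, A e b ∈ m

namespace Res

variable {Z : Type*} [AddCommGroup Z] [Module R Z] (P : Res I m)

/-- Exactness of the augmented resolution with coefficients in a filtered module. -/
structure Exact (W₀ W₁ W₂ : Submodule R Z) : Prop where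
  surj : ∀ y ∈ W₁, ∃ v : P.Γ → Z, (∀ a, v a ∈ W₀) ∧ (∀ a, P.deg a ≠ 0 → v a = 0) ∧
    y - ∑ a, P.φ a • v a ∈ W₂
  zero : ∀ v : P.Γ → Z, (∀ a, v a ∈ W₀) → ∑ a, P.φ a • v a ∈ W₂ → ∃ w : P.Γ → Z,
    (∀ a, w a ∈ W₀) ∧ (∀ a, P.deg a ≠ 1 → w a = 0) ∧
      ∀ a, P.deg a = 0 → v a - act P.A w a ∈ W₁
  succ : ∀ i, ∀ v : P.Γ → Z, (∀ a, v a ∈ W₀) → (∀ a, P.deg a = i → act P.A v a ∈ W₁) →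
    ∃ w : P.Γ → Z, (∀ a, w a ∈ W₀) ∧ (∀ a, P.deg a ≠ i + 2 → w a = 0) ∧
      ∀ a, P.deg a = i + 1 → v a - act P.A w a ∈ W₁

/-- Exactness with coefficients in all graded pieces of a system. -/
def Good (Y : Sys I Z) : Prop := ∀ n, P.Exact (Y.F 0 n) (Y.F 1 n) (Y.F 2 n)

variable {P}

theorem Exact.pi {ι : Type*} {Z : ι → Type*} [∀ i, AddCommGroup (Z i)] [∀ i, Module R (Z i)]
    {W₀ W₁ W₂ : ∀ i, Submodule R (Z i)} (h : ∀ i, P.Exact (W₀ i) (W₁ i) (W₂ i)) :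
    P.Exact (Submodule.pi Set.univ W₀) (Submodule.pi Set.univ W₁)
      (Submodule.pi Set.univ W₂) := by
  have hact : ∀ (v : P.Γ → ∀ i, Z i) (a : P.Γ) (i : ι),
      act P.A v a i = act P.A (fun a => v a i) a := fun v a i => by simp [act_apply]
  constructor
  · intro y hy
    choose v h1 h2 h3 using fun i => (h i).surj (y i) (hy i trivial)
    exact ⟨fun a i => v i a, fun a i _ => h1 i a, fun a ha => funext fun i => h2 i a ha,
      fun i _ => by simpa using h3 i⟩
  · intro v hv hv'
    choose w h1 h2 h3 using fun i => (h i).zero (fun a => v a i) (fun a => hv a i trivial)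
      (by simpa using hv' i trivial)
    exact ⟨fun a i => w i a, fun a i _ => h1 i a, fun a ha => funext fun i => h2 i a ha,
      fun a ha i _ => by simpa [hact] using h3 i a ha⟩
  · intro n v hv hv'
    choose w h1 h2 h3 using fun i => (h i).succ n (fun a => v a i) (fun a => hv a i trivial)
      (fun a ha => by simpa [hact] using hv' a ha i trivial)
    exact ⟨fun a i => w i a, fun a i _ => h1 i a, fun a ha => funext fun i => h2 i a ha,
      fun a ha i _ => by simpa [hact] using h3 i a ha⟩

theorem Exact.bot : P.Exact (⊥ : Submodule R Z) ⊥ ⊥ where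
  surj y hy := ⟨0, by simp, by simp, by simpa using hy⟩
  zero v hv _ := ⟨0, by simp, by simp, fun a _ => by simpa using hv a⟩
  succ _ v hv _ := ⟨0, by simp, by simp, fun a _ => by simpa using hv a⟩

theorem Good.tensor {Y : Sys I Z} (h : P.Good Y) (N : Cx I) : P.Good (N.tensor Y) :=
  fun n => Exact.pi fun c => h (n - N.deg c)

theorem good_dual (h : P.Exact (I ^ 0) (I ^ 1) (I ^ 2)) (N : Cx I) : P.Good N.dual :=
  fun n => Exact.pi fun c => by
    split_ifs
    · exact h
    · exact Exact.bot

variable (P)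

theorem lift {Y : Sys I Z} (hY : P.Good Y) {n : ℤ} {u : P.Γ → Z}
    (hu : u ∈ (P.tensor Y).F 0 n) (hDu : (P.tensor Y).δ u ∈ (P.tensor Y).F 1 (n - 1))
    {y : Z} (hy : y ∈ Y.F 1 (n + 1)) (huy : ∑ a, P.φ a • u a - Y.δ y ∈ Y.F 2 n) :
    ∃ v ∈ (P.tensor Y).F 0 (n + 1), ∑ a, P.φ a • v a - y ∈ Y.F 2 (n + 1) ∧
      u - (P.tensor Y).δ v ∈ (P.tensor Y).F 1 n := by
  have main : ∀ i : ℕ, ∃ v ∈ (P.tensor Y).F 0 (n + 1), ∑ a, P.φ a • v a - y ∈ Y.F 2 (n + 1) ∧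
      ∀ a, P.deg a < i + 1 → (u - (P.tensor Y).δ v) a ∈ Y.F 1 (n - P.deg a) := by
    intro i
    induction i with
    | zero =>
      obtain ⟨v, h1, h2, h3⟩ := (hY (n + 1)).surj y hy
      have hr : ∀ a, P.deg a = 0 → u a - Y.δ (v a) ∈ Y.F 0 n := fun a ha =>
        sub_mem (Y.cast (Cx.mem_tensor.1 hu a) (by simp [ha]))
          (Y.cast (Y.δ_mem _ _ _ (h1 a)) (by ring))
      obtain ⟨w, w1, w2, w3⟩ := (hY n).zero
        (fun a => if P.deg a = 0 then u a - Y.δ (v a) else 0) (fun a => by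
          split_ifs with h
          exacts [hr a h, zero_mem _]) (by
          have : ∑ a, P.φ a • (if P.deg a = 0 then u a - Y.δ (v a) else 0) =
              (∑ a, P.φ a • u a - Y.δ y) + Y.δ (y - ∑ a, P.φ a • v a) := by
            rw [map_sub, map_sum, sub_add_sub_cancel, ← Finset.sum_sub_distrib]
            refine Finset.sum_congr rfl fun a _ => ?_
            by_cases h : P.φ a = 0
            · simp [h]
            · rw [if_pos (P.φ_deg a h), smul_sub, map_smul]
          rw [this]
          exact add_mem huy (Y.cast (Y.δ_mem _ _ _ h3) (by ring)))
      refine ⟨v + w, Cx.mem_tensor.2 fun a => ?_, ?_, fun a ha => ?_⟩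
      · by_cases h : P.deg a = 0
        · simpa [h, w2] using h1 a
        · rw [Pi.add_apply, h2 a h, zero_add]
          by_cases h' : P.deg a = 1
          · exact Y.cast (w1 a) (by simp [h'])
          · simp [w2 a h']
      · have : ∑ a, P.φ a • (v + w) a = ∑ a, P.φ a • v a :=
          Finset.sum_congr rfl fun a _ => by
            by_cases h : P.φ a = 0
            · simp [h]
            · simp [w2 a (by rw [P.φ_deg a h]; decide)]
        rw [this, ← neg_sub]
        exact neg_mem h3
      · have ha : P.deg a = 0 := by omega
        refine Y.cast (m := n) ?_ (by simp [ha])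
        convert w3 a ha using 1
        rw [if_pos ha, Pi.sub_apply, Cx.tensor_δ, Cx.diff_apply, map_add]
        have : act P.A v a = 0 := Finset.sum_eq_zero fun b _ => by
          by_cases h : P.A a b = 0
          · simp [h]
          · rw [h2 b (by rw [P.deg_eq _ _ h]; omega), smul_zero]
        simp only [Pi.add_apply, this, zero_add, w2 a (by omega), add_zero, ha, pow_zero, one_smul]
        abel
    | succ i ih =>
      obtain ⟨v, hv, hvy, hr⟩ := ih
      set r := u - (P.tensor Y).δ v with hr_def
      have hr0 : r ∈ (P.tensor Y).F 0 n :=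
        sub_mem hu ((P.tensor Y).cast ((P.tensor Y).δ_mem _ _ _ hv) (by ring))
      have hDr : (P.tensor Y).δ r ∈ (P.tensor Y).F 1 (n - 1) := by
        rw [hr_def, map_sub]
        exact sub_mem hDu ((P.tensor Y).cast ((P.tensor Y).δδ _ _ hv) (by ring))
      obtain ⟨w, w1, w2, w3⟩ := (hY (n - 1 - i)).succ i
        (fun a => if P.deg a = i + 1 then r a else 0) (fun a => by
          split_ifs with h
          exacts [Y.cast (Cx.mem_tensor.1 hr0 a) (by rw [h]; push_cast; ring), zero_mem _])
        (fun a ha => by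
          have h1 := Cx.mem_tensor.1 hDr a
          rw [Cx.tensor_δ, Cx.diff_apply] at h1
          have h2 := sub_mem h1 (Submodule.smul_mem _ ((-1 : R) ^ P.deg a)
            (Y.cast (Y.δ_mem _ _ _ (hr a (by omega))) (show _ = n - 1 - P.deg a by ring)))
          rw [add_sub_cancel_right] at h2
          rw [ha] at h2
          convert h2 using 1
          refine Finset.sum_congr rfl fun b _ => ?_
          by_cases h : P.A a b = 0
          · simp [h]
          · beta_reduce
            rw [if_pos (by rw [P.deg_eq _ _ h, ha])])
      have hDw : ∀ a, P.deg a < i + 2 → (P.tensor Y).δ w a = act P.A w a := fun a ha => by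
        rw [Cx.tensor_δ, Cx.diff_apply, w2 a (by omega), map_zero, smul_zero, add_zero]
      refine ⟨v + w, add_mem hv (Cx.mem_tensor.2 fun a => ?_), ?_, fun a ha => ?_⟩
      · by_cases h : P.deg a = i + 2
        · exact Y.cast (w1 a) (by rw [h]; push_cast; ring)
        · simp [w2 a h]
      · have : ∑ a, P.φ a • (v + w) a = ∑ a, P.φ a • v a :=
          Finset.sum_congr rfl fun a _ => by
            by_cases h : P.φ a = 0
            · simp [h]
            · simp [w2 a (by rw [P.φ_deg a h]; omega)]
        rwa [this]
      · have e1 : (u - (P.tensor Y).δ (v + w)) a = r a - act P.A w a := by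
          rw [map_add, ← sub_sub, Pi.sub_apply, hDw a (by omega)]
        rw [e1]
        by_cases h : P.deg a = i + 1
        · have := w3 a h
          rw [if_pos h] at this
          exact Y.cast this (by rw [h]; push_cast; ring)
        · refine sub_mem (hr a (by omega)) (sum_mem fun b _ => ?_)
          by_cases h' : P.A a b = 0
          · simp [h']
          · rw [w2 b (by rw [P.deg_eq _ _ h']; omega)]; simp
  obtain ⟨v, hv, h1, h2⟩ := main (∑ a, P.deg a)
  refine ⟨v, hv, h1, Cx.mem_tensor.2 fun a => h2 a ?_⟩
  exact Nat.lt_succ_of_le (Finset.single_le_sum (f := P.deg) (fun _ _ => Nat.zero_le _)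
    (Finset.mem_univ a))

end Res

end Core

section Core

variable {R : Type*} [CommRing R] {I m : Ideal R}

namespace Res

variable {Z : Type*} [AddCommGroup Z] [Module R Z] (P : Res I m)

/-- The tensor product of a resolution with a finite free complex. -/
def mul (N : Cx I) : Cx I where
  Γ := P.Γ × N.Γ
  deg x := P.deg x.1 + N.deg x.2
  A x y := (if x.2 = y.2 then P.A x.1 y.1 else 0) +
    (if x.1 = y.1 then (-1) ^ P.deg x.1 * N.A x.2 y.2 else 0)
  deg_eq x y h := by
    split_ifs at h with h1 h2 h2
    · rw [h1, h2]
      rcases eq_or_ne (P.A x.1 y.1) 0 with h3 | h3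
      · rw [h3, zero_add] at h
        have := N.deg_eq _ _ (right_ne_zero_of_mul h)
        simp [h1] at this
      · have := P.deg_eq _ _ h3
        simp [h2] at this
    · rw [add_zero] at h
      rw [h1, P.deg_eq _ _ h]; omega
    · rw [zero_add] at h
      rw [h2, N.deg_eq _ _ (right_ne_zero_of_mul h)]; omega
    · simp at h
  sq x z := by
    obtain ⟨a, c⟩ := x
    obtain ⟨a', c'⟩ := z
    have key : ∑ y : P.Γ × N.Γ, ((if c = y.2 then P.A a y.1 else 0) +
        (if a = y.1 then (-1) ^ P.deg a * N.A c y.2 else 0)) *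
        ((if y.2 = c' then P.A y.1 a' else 0) +
        (if y.1 = a' then (-1) ^ P.deg y.1 * N.A y.2 c' else 0)) =
        (if c = c' then ∑ b, P.A a b * P.A b a' else 0) +
        (if a = a' then ∑ d, N.A c d * N.A d c' else 0) := by
      rw [Fintype.sum_prod_type]
      simp only [add_mul, mul_add, ite_mul, mul_ite, zero_mul, mul_zero, Finset.sum_add_distrib,
        Finset.sum_ite_eq, Finset.sum_ite_eq', Finset.mem_univ, if_true, Finset.sum_const_zero,
        Finset.sum_ite_irrel]
      have h1 : P.A a a' * ((-1) ^ P.deg a' * N.A c c') +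
          (-1) ^ P.deg a * N.A c c' * P.A a a' = 0 := by
        by_cases h : P.A a a' = 0
        · simp [h]
        · rw [P.deg_eq _ _ h]; ring
      have h2 : ((-1 : R) ^ P.deg a) * (-1) ^ P.deg a = 1 := by
        rw [← pow_add]; exact Even.neg_one_pow ⟨_, rfl⟩
      have h3 : (if a = a' then ∑ d, (-1) ^ P.deg a * N.A c d * ((-1) ^ P.deg a' * N.A d c')
          else 0) = if a = a' then ∑ d, N.A c d * N.A d c' else 0 := by
        split_ifs with h
        · subst h
          refine Finset.sum_congr rfl fun d _ => ?_
          linear_combination (N.A c d * N.A d c') * h2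
        · rfl
      rw [h3]
      linear_combination h1
    refine key ▸ add_mem ?_ ?_
    · split_ifs
      exacts [P.sq _ _, zero_mem _]
    · split_ifs
      exacts [N.sq _ _, zero_mem _]

variable {P}

theorem mul_diff (N : Cx I) (Y : Sys I Z) (x : P.Γ → N.Γ → Z) (a : P.Γ) (c : N.Γ) :
    ((P.mul N).tensor Y).δ (fun y => x y.1 y.2) (a, c) = (P.tensor (N.tensor Y)).δ x a c := by
  change ∑ y : P.Γ × N.Γ, ((if c = y.2 then P.A a y.1 else 0) +
    (if a = y.1 then (-1) ^ P.deg a * N.A c y.2 else 0)) • x y.1 y.2 +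
    (-1 : R) ^ (P.deg a + N.deg c) • Y.δ (x a c) = _
  simp only [Cx.tensor_δ, Cx.diff_apply, act_apply, Fintype.sum_prod_type, add_smul, ite_smul,
    zero_smul, Finset.sum_add_distrib, Finset.sum_ite_eq, Finset.mem_univ, if_true, pow_add,
    Finset.sum_const_zero, Finset.sum_ite_irrel, Pi.add_apply, Finset.sum_apply, Pi.smul_apply,
    smul_add, Finset.smul_sum, smul_smul, add_assoc]

theorem mem_mul {N : Cx I} {Y : Sys I Z} {j : ℕ} {n : ℤ} {x : P.Γ → N.Γ → Z} :
    (fun y : (P.mul N).Γ => x y.1 y.2) ∈ ((P.mul N).tensor Y).F j n ↔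
      x ∈ (P.tensor (N.tensor Y)).F j n := by
  have h : ∀ a c, n - ((P.mul N).deg (a, c) : ℤ) = n - P.deg a - N.deg c := fun a c => by
    simp [mul, sub_sub]
  rw [Cx.mem_tensor, Cx.mem_tensor]
  exact ⟨fun H a => Cx.mem_tensor.2 fun c => Y.cast (H (a, c)) (h a c),
    fun H y => Y.cast (Cx.mem_tensor.1 (H y.1) y.2) (h y.1 y.2).symm⟩

/-- The filtered system together with the homotopy operator `t` attached to `f`. -/
structure Op (Y : Sys I Z) (f : R) where
  t : Z →ₗ[R] Z
  t_mem : ∀ j n x, x ∈ Y.F j n → t x ∈ Y.F j (n - 2)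
  t_δ : ∀ x, t (Y.δ x) = Y.δ (t x)
  δδ : ∀ x, Y.δ (Y.δ x) = f • t x

/-- Coordinatewise application of the operator. -/
def Op.map {Y : Sys I Z} {f : R} (T : Op Y f) (Γ : Type) : (Γ → Z) →ₗ[R] (Γ → Z) :=
  T.t.compLeft Γ

theorem Op.map_apply {Y : Sys I Z} {f : R} (T : Op Y f) {Γ : Type} (x : Γ → Z) (c : Γ) :
    T.map Γ x c = T.t (x c) := rfl

theorem Op.map_mem {Y : Sys I Z} {f : R} (T : Op Y f) {N : Cx I} {j : ℕ} {n : ℤ} {x : N.Γ → Z}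
    (hx : x ∈ (N.tensor Y).F j n) : T.map N.Γ x ∈ (N.tensor Y).F j (n - 2) :=
  Cx.mem_tensor.2 fun c => Y.cast (T.t_mem _ _ _ (Cx.mem_tensor.1 hx c)) (by ring)

theorem Op.map_δ {Y : Sys I Z} {f : R} (T : Op Y f) {N : Cx I} (x : N.Γ → Z) :
    T.map N.Γ ((N.tensor Y).δ x) = (N.tensor Y).δ (T.map N.Γ x) := by
  ext c
  simp only [Op.map_apply, Cx.tensor_δ, Cx.diff_apply, map_add, map_smul, T.t_δ]
  congr 1
  exact (act_map _ _ _ _).symm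

/-- Homotopy for the square of the differential of `N`. -/
theorem exists_homotopy (hP : P.Exact (I ^ 0) (I ^ 1) (I ^ 2)) (N : Cx I) :
    ∃ h : P.Γ → N.Γ → N.Γ → R, (∀ a c c', h a c c' ≠ 0 → P.deg a + N.deg c + 2 = N.deg c') ∧
      (∀ c c', ∑ a, P.φ a * h a c c' - ∑ d, N.A c d * N.A d c' ∈ I ^ 2) ∧
      ∀ a c c', ∑ b, P.A a b * h b c c' + (-1) ^ P.deg a * ∑ d, N.A c d * h a d c' -
        ∑ d, h a c d * N.A d c' ∈ I := by
  let A2 : N.Γ → N.Γ → R := fun c c' => ∑ d, N.A c d * N.A d c'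
  have hA2 : A2 ∈ (N.tensor N.dual).F 1 (-3 + 1) := by
    refine Cx.mem_tensor.2 fun c => N.mem_dual.2 fun c' => ?_
    split_ifs with h
    · simpa using N.sq c c'
    · refine (Submodule.mem_bot R).2 (Finset.sum_eq_zero fun d _ => ?_)
      by_contra h'
      have h1 := N.deg_eq _ _ (left_ne_zero_of_mul h')
      have h2 := N.deg_eq _ _ (right_ne_zero_of_mul h')
      omega
  have hδ : (N.tensor N.dual).δ A2 = 0 := by
    ext c c'
    rw [Cx.tensor_δ, Cx.diff_apply]
    simp only [act_apply, Pi.add_apply, Finset.sum_apply, Pi.smul_apply, Cx.dual_δ, smul_eq_mul,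
      A2, Pi.zero_apply]
    simp only [Finset.mul_sum, Finset.sum_mul, mul_neg]
    rw [add_neg_eq_zero, Finset.sum_comm]
    refine Finset.sum_congr rfl fun d _ => Finset.sum_congr rfl fun d' _ => ?_
    by_cases h1 : N.A c d' = 0
    · simp [h1]
    by_cases h2 : N.A d' d = 0
    · simp [h2]
    rw [N.deg_eq _ _ h2, N.deg_eq _ _ h1]
    have h2 : ((-1 : R) ^ N.deg c) * (-1) ^ N.deg c = 1 := by
      rw [← pow_add]; exact Even.neg_one_pow ⟨_, rfl⟩
    linear_combination (- N.A c d' * N.A d' d * N.A d c') * h2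
  obtain ⟨h, h1, h2, h3⟩ := P.lift ((good_dual hP N).tensor N) (n := -3) (u := 0) (zero_mem _)
    (by simp) hA2 (by simp [hδ])
  have hdeg : ∀ a c c', h a c c' ≠ 0 → P.deg a + N.deg c + 2 = N.deg c' := fun a c c' hne => by
    have := N.mem_dual.1 (Cx.mem_tensor.1 (Cx.mem_tensor.1 h1 a) c) c'
    split_ifs at this with hh
    · omega
    · exact absurd this hne
  refine ⟨h, hdeg, fun c c' => ?_, fun a c c' => ?_⟩
  · have := N.mem_dual.1 (Cx.mem_tensor.1 h2 c) c'
    split_ifs at this with hh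
    · simpa [A2] using this
    · have := (Submodule.mem_bot R).1 this
      simp only [Pi.sub_apply, Finset.sum_apply, Pi.smul_apply, smul_eq_mul] at this
      rw [this]; exact zero_mem _
  · have := N.mem_dual.1 (Cx.mem_tensor.1 (Cx.mem_tensor.1 h3 a) c) c'
    rw [zero_sub, Pi.neg_apply, Pi.neg_apply, Pi.neg_apply, neg_mem_iff] at this
    have h4 : (P.tensor (N.tensor N.dual)).δ h a c c' = ∑ b, P.A a b * h b c c' +
        (-1) ^ P.deg a * ∑ d, N.A c d * h a d c' - ∑ d, h a c d * N.A d c' := by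
      rw [Cx.tensor_δ, Cx.diff_apply, Cx.tensor_δ, Pi.add_apply, Pi.smul_apply, Cx.diff_apply]
      simp only [act_apply, Pi.add_apply, Finset.sum_apply, Pi.smul_apply, Cx.dual_δ, smul_eq_mul]
      rw [mul_add, add_sub_assoc, sub_eq_add_neg]
      congr 2
      rw [← mul_assoc, ← pow_add, mul_neg, Finset.mul_sum]
      congr 1
      refine Finset.sum_congr rfl fun d _ => ?_
      by_cases h' : h a c d = 0
      · simp [h']
      · rw [← hdeg a c d h', ← mul_assoc, ← mul_assoc, ← pow_add,
          Even.neg_one_pow ⟨P.deg a + N.deg c + 1, by ring⟩, one_mul]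
    rw [h4] at this
    split_ifs at this with hh
    · simpa using this
    · rw [(Submodule.mem_bot R).1 this]; exact zero_mem _

end Res

end Core

section Core

variable {R : Type*} [CommRing R] {I m : Ideal R}

namespace Res

variable {Z : Type*} [AddCommGroup Z] [Module R Z] {P : Res I m}

theorem bd_mul {N : Cx I} {Y : Sys I Z} {n : ℤ} {u v : P.Γ → N.Γ → Z}
    (hv : v ∈ (P.tensor (N.tensor Y)).F 0 (n + 1))
    (h : u - (P.tensor (N.tensor Y)).δ v ∈ (P.tensor (N.tensor Y)).F 1 n) :
    ((P.mul N).tensor Y).Bd n (fun y => u y.1 y.2) := by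
  refine ⟨_, mem_mul.2 hv, ?_⟩
  convert mem_mul.2 h using 1
  funext y
  exact congrArg (u y.1 y.2 - ·) (mul_diff N Y v y.1 y.2)

/-- One step of the comparison between the operator `t` and a homotopy matrix. -/
theorem exists_step (hP : P.Exact (I ^ 0) (I ^ 1) (I ^ 2)) (N : Cx I) {Y : Sys I Z}
    (hY : P.Good Y) (T : Op Y (P.φ P.e)) :
    ∃ h : P.Γ → N.Γ → N.Γ → R, (∀ a c c', h a c c' ≠ 0 → P.deg a + N.deg c + 2 = N.deg c') ∧
      (∀ n x, (N.tensor Y).Cyc n x → ((P.mul N).tensor Y).Bd (n - 2) (fun y =>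
        (if y.1 = P.e then T.t (x y.2) else 0) + act (h y.1) x y.2)) ∧
      ∀ n x, (N.tensor Y).Bd n x → ((P.mul N).tensor Y).Bd (n - 2) (fun y =>
        act (h y.1) x y.2) := by
  obtain ⟨h, h1, h2, h3⟩ := exists_homotopy hP N
  have hmem : ∀ j n x, x ∈ (N.tensor Y).F j n →
      (fun a => act (h a) x) ∈ (P.tensor (N.tensor Y)).F j (n - 2) := by
    refine fun j n x hx => Cx.mem_tensor.2 fun a => Cx.mem_tensor.2 fun c =>
      sum_mem fun c' _ => ?_
    by_cases h' : h a c c' = 0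
    · simp [h']
    · exact Submodule.smul_mem _ _ (Y.cast (Cx.mem_tensor.1 hx c')
        (by rw [← h1 a c c' h']; push_cast; ring))
  have hkey : ∀ n z, z ∈ (N.tensor Y).F 0 n →
      (P.tensor (N.tensor Y)).δ (fun a => act (h a) z) - (fun a => act (h a) ((N.tensor Y).δ z)) ∈
        (P.tensor (N.tensor Y)).F 1 (n - 2 - 1) := by
    refine fun n z hz => Cx.mem_tensor.2 fun a => Cx.mem_tensor.2 fun c => ?_
    have e1 : ((P.tensor (N.tensor Y)).δ (fun a => act (h a) z) -
        (fun a => act (h a) ((N.tensor Y).δ z))) a c =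
        ∑ c', (∑ b, P.A a b * h b c c' + (-1) ^ P.deg a * ∑ d, N.A c d * h a d c' -
        ∑ d, h a c d * N.A d c') • z c' := by
      have s1 : act (h a) ((N.tensor Y).δ z) c = ∑ c', (∑ d, h a c d * N.A d c') • z c' +
          (-1 : R) ^ P.deg a • (-1 : R) ^ N.deg c • Y.δ (act (h a) z c) := by
        have e2 : (N.tensor Y).δ z = act N.A z + fun d => (-1 : R) ^ N.deg d • Y.δ (z d) := rfl
        rw [e2, map_add, act_act, Pi.add_apply, act_apply]
        congr 1
        simp only [act_apply, map_sum, Finset.smul_sum, map_smul]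
        refine Finset.sum_congr rfl fun d _ => ?_
        by_cases h' : h a c d = 0
        · simp [h']
        · rw [← h1 a c d h', smul_smul, smul_smul, smul_smul]
          congr 1
          ring
      have s2 : ∑ b, P.A a b • act (h b) z c = ∑ c', (∑ b, P.A a b * h b c c') • z c' := by
        simp only [act_apply, Finset.smul_sum, Finset.sum_smul, smul_smul]
        rw [Finset.sum_comm]
      rw [Pi.sub_apply, Pi.sub_apply, s1, Cx.tensor_δ, Cx.diff_apply, Pi.add_apply, act_apply,
        Finset.sum_apply, Pi.smul_apply, Cx.tensor_δ, Cx.diff_apply, act_act, act_apply]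
      simp only [Pi.smul_apply]
      rw [s2, smul_add]
      simp only [add_smul, sub_smul, Finset.sum_add_distrib, Finset.sum_sub_distrib, mul_smul,
        ← Finset.smul_sum]
      abel
    rw [e1]
    refine sum_mem fun c' _ => ?_
    by_cases hd : N.deg c' = P.deg a + N.deg c + 3
    · exact Y.cast (Y.smul _ _ _ _ (h3 a c c') (Cx.mem_tensor.1 hz c'))
        (by rw [hd]; push_cast; ring)
    · rw [Finset.sum_eq_zero, Finset.sum_eq_zero, Finset.sum_eq_zero]
      · simp
      all_goals
        intro d _
        by_contra h'
        have g1 := left_ne_zero_of_mul h'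
        have g2 := right_ne_zero_of_mul h'
      · have := h1 _ _ _ g1
        have := N.deg_eq _ _ g2
        omega
      · have := N.deg_eq _ _ g1
        have := h1 _ _ _ g2
        omega
      · have := P.deg_eq _ _ g1
        have := h1 _ _ _ g2
        omega
  refine ⟨h, h1, fun n x hx => ?_, fun n x hx => ?_⟩
  · let u : P.Γ → N.Γ → Z := fun a => (if a = P.e then T.map N.Γ x else 0) + act (h a) x
    let w : P.Γ → N.Γ → Z := fun a => if a = P.e then T.map N.Γ x else 0
    have hw : u = w + fun a => act (h a) x := rfl
    have hδw : (P.tensor (N.tensor Y)).δ w =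
        fun a => if a = P.e then T.map N.Γ ((N.tensor Y).δ x) else 0 := by
      ext1 a
      rw [Cx.tensor_δ, Cx.diff_apply]
      have : act P.A w a = 0 := Finset.sum_eq_zero fun b _ => by
        by_cases hb : b = P.e
        · have : P.A a b = 0 := by
            by_contra h'
            have := P.deg_eq _ _ h'
            rw [hb, P.deg_e] at this; omega
          rw [this, zero_smul]
        · simp [w, hb]
      rw [this, zero_add]
      by_cases ha : a = P.e
      · simp [w, ha, P.deg_e, T.map_δ]
      · simp [w, ha]
    have hu : u ∈ (P.tensor (N.tensor Y)).F 0 (n - 2) := by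
      rw [hw]
      refine add_mem (Cx.mem_tensor.2 fun a => ?_) (hmem _ _ _ hx.1)
      by_cases ha : a = P.e
      · simp only [w, ha, if_true, P.deg_e]
        exact (N.tensor Y).cast (T.map_mem hx.1) (by simp)
      · simp [w, ha]
    have hDu : (P.tensor (N.tensor Y)).δ u ∈ (P.tensor (N.tensor Y)).F 1 (n - 2 - 1) := by
      rw [hw, map_add, hδw]
      refine add_mem (Cx.mem_tensor.2 fun a => ?_) ?_
      · by_cases ha : a = P.e
        · simp only [ha, if_true, P.deg_e]
          exact (N.tensor Y).cast (T.map_mem hx.2) (by push_cast; ring)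
        · simp [ha]
      · have := add_mem (hkey _ _ hx.1) ((P.tensor (N.tensor Y)).cast (hmem _ _ _ hx.2)
          (by ring))
        rwa [sub_add_cancel] at this
    have huy : ∑ a, P.φ a • u a - (N.tensor Y).δ ((N.tensor Y).δ x) ∈
        (N.tensor Y).F 2 (n - 2) := by
      refine Cx.mem_tensor.2 fun c => ?_
      have e3 : (∑ a, P.φ a • u a - (N.tensor Y).δ ((N.tensor Y).δ x)) c =
          ∑ c', (∑ a, P.φ a * h a c c' - ∑ d, N.A c d * N.A d c') • x c' := by
        rw [Pi.sub_apply, Cx.tensor_δ, Cx.tensor_δ, Cx.diff_diff, T.δδ, act_apply]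
        simp only [u, smul_add, Finset.sum_add_distrib, smul_ite, smul_zero,
          Finset.sum_ite_eq', Finset.mem_univ, if_true]
        simp only [Pi.add_apply, Finset.sum_apply, Pi.smul_apply, act_apply, Op.map_apply,
          sub_smul, Finset.sum_sub_distrib,
          Finset.sum_smul, Finset.smul_sum, smul_smul]
        rw [show (∑ a, ∑ c', (P.φ a * h a c c') • x c') =
          ∑ c', ∑ a, (P.φ a * h a c c') • x c' from Finset.sum_comm]
        abel
      rw [e3]
      refine sum_mem fun c' _ => ?_
      by_cases hd : N.deg c' = N.deg c + 2
      · have := h2 c c'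
        refine Y.cast (m := n - N.deg c') ?_ (by rw [hd]; push_cast; ring)
        have hx' := Cx.mem_tensor.1 hx.1 c'
        generalize (∑ a, P.φ a * h a c c' - ∑ d, N.A c d * N.A d c') = r at this
        rw [pow_two] at this
        refine Submodule.mul_induction_on this (fun a ha b hb => ?_) (fun a b ha hb => ?_)
        · rw [mul_smul]
          exact Y.smul _ _ _ _ ha (Y.smul _ _ _ _ hb hx')
        · rw [add_smul]; exact add_mem ha hb
      · rw [Finset.sum_eq_zero, Finset.sum_eq_zero]
        · simp
        all_goals
          intro d _
          by_contra h'
          have g1 := left_ne_zero_of_mul h'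
          have g2 := right_ne_zero_of_mul h'
        · have := N.deg_eq _ _ g1
          have := N.deg_eq _ _ g2
          omega
        · have := P.φ_deg _ g1
          have := h1 _ _ _ g2
          omega
    obtain ⟨v, hv, -, hv'⟩ := P.lift (hY.tensor N) hu hDu
      ((N.tensor Y).cast hx.2 (by ring)) huy
    convert bd_mul hv hv' using 1
    ext y
    simp only [u, Pi.add_apply]
    congr 1
    split_ifs <;> rfl
  · obtain ⟨z, hz, hz'⟩ := hx
    refine bd_mul (u := fun a => act (h a) x) ((P.tensor (N.tensor Y)).cast
      (hmem _ _ _ hz) (by ring)) ?_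
    convert sub_mem (hmem _ _ _ hz') ((P.tensor (N.tensor Y)).cast (hkey _ _ hz)
      (show _ = n - 2 by ring)) using 1
    ext1 a
    simp only [Pi.sub_apply, map_sub]
    abel

end Res

end Core

section Core

variable {R : Type*} [CommRing R] {I m : Ideal R}

/-- An extension of a free complex by cells whose incidence to the original cells is in `m`. -/
structure Ext (N : Cx I) (m : Ideal R) where
  E : Cx I
  ι : N.Γ → E.Γ
  inj : Function.Injective ι
  deg_ι : ∀ c, E.deg (ι c) = N.deg c
  A_ι : ∀ c c', E.A (ι c) (ι c') = N.A c c'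
  A_off : ∀ γ c, γ ∉ Set.range ι → E.A γ (ι c) = 0
  A_mem : ∀ γ c, γ ∉ Set.range ι → E.A (ι c) γ ∈ m
  le_deg : ∀ s, (∀ c, s ≤ N.deg c) → ∀ γ, s ≤ E.deg γ

namespace Ext

variable {Z : Type*} [AddCommGroup Z] [Module R Z] {N : Cx I}

/-- Extension by zero of vectors. -/
def push (X : Ext N m) (x : N.Γ → Z) : X.E.Γ → Z :=
  fun γ => ∑ c, if X.ι c = γ then x c else 0

variable {X : Ext N m}

omit [Module R Z] in
theorem push_ι (x : N.Γ → Z) (c : N.Γ) : X.push x (X.ι c) = x c := by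
  simp [push, X.inj.eq_iff]

omit [Module R Z] in
theorem push_off (x : N.Γ → Z) {γ : X.E.Γ} (h : γ ∉ Set.range X.ι) : X.push x γ = 0 :=
  Finset.sum_eq_zero fun c _ => if_neg fun e => h ⟨c, e⟩

theorem act_push (A : X.E.Γ → X.E.Γ → R) (x : N.Γ → Z) (γ : X.E.Γ) :
    act A (X.push x) γ = ∑ c, A γ (X.ι c) • x c := by
  simp only [act_apply, push, Finset.smul_sum, smul_ite, smul_zero]
  rw [Finset.sum_comm]
  simp

theorem δ_push (Y : Sys I Z) (x : N.Γ → Z) :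
    (X.E.tensor Y).δ (X.push x) = X.push ((N.tensor Y).δ x) := by
  funext γ
  rw [Cx.tensor_δ, Cx.diff_apply, act_push]
  by_cases h : γ ∈ Set.range X.ι
  · obtain ⟨c, rfl⟩ := h
    simp only [push_ι, X.A_ι, X.deg_ι]
    rfl
  · simp [push_off _ h, X.A_off γ _ h]

theorem push_mem {Y : Sys I Z} {j : ℕ} {n : ℤ} {x : N.Γ → Z} (hx : x ∈ (N.tensor Y).F j n) :
    X.push x ∈ (X.E.tensor Y).F j n := by
  refine Cx.mem_tensor.2 fun γ => ?_
  by_cases h : γ ∈ Set.range X.ι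
  · obtain ⟨c, rfl⟩ := h
    rw [push_ι, X.deg_ι]
    exact Cx.mem_tensor.1 hx c
  · rw [push_off _ h]; exact zero_mem _

theorem push_cyc {Y : Sys I Z} {n : ℤ} {x : N.Γ → Z} (hx : (N.tensor Y).Cyc n x) :
    (X.E.tensor Y).Cyc n (X.push x) :=
  ⟨push_mem hx.1, by rw [δ_push]; exact push_mem hx.2⟩

variable (N m) in
/-- The trivial extension. -/
def refl : Ext N m where
  E := N
  ι := id
  inj := Function.injective_id
  deg_ι _ := rfl
  A_ι _ _ := rfl
  A_off γ _ h := absurd ⟨γ, rfl⟩ h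
  A_mem γ _ h := absurd ⟨γ, rfl⟩ h
  le_deg _ h := h

variable (X) in
/-- Tensoring an extension with a resolution. -/
def mul (P : Res I m) : Ext N m where
  E := P.mul X.E
  ι c := (P.e, X.ι c)
  inj c c' h := X.inj (congrArg Prod.snd h)
  deg_ι c := by
    change P.deg P.e + X.E.deg (X.ι c) = _
    rw [P.deg_e, zero_add, X.deg_ι]
  A_ι c c' := by
    change (if X.ι c = X.ι c' then P.A P.e P.e else 0) +
      (if P.e = P.e then (-1) ^ P.deg P.e * X.E.A (X.ι c) (X.ι c') else 0) = _
    have : P.A P.e P.e = 0 := by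
      by_contra h
      have := P.deg_eq _ _ h
      omega
    simp [this, P.deg_e, X.A_ι]
  A_off := by
    rintro ⟨a, γ⟩ c h
    change (if γ = X.ι c then P.A a P.e else 0) +
      (if a = P.e then (-1) ^ P.deg a * X.E.A γ (X.ι c) else 0) = 0
    have h1 : P.A a P.e = 0 := by
      by_contra h
      have := P.deg_eq _ _ h
      rw [P.deg_e] at this
      omega
    rw [h1, ite_self, zero_add]
    split_ifs with ha
    · rw [X.A_off, mul_zero]
      rintro ⟨d, rfl⟩
      exact h ⟨d, by rw [ha]⟩
    · rfl
  A_mem := by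
    rintro ⟨a, γ⟩ c h
    change (if X.ι c = γ then P.A P.e a else 0) +
      (if P.e = a then (-1) ^ P.deg P.e * X.E.A (X.ι c) γ else 0) ∈ m
    refine add_mem ?_ ?_
    · split_ifs
      exacts [P.A_e _, zero_mem _]
    · split_ifs with ha
      · refine Ideal.mul_mem_left _ _ (X.A_mem _ _ ?_)
        rintro ⟨d, rfl⟩
        exact h ⟨d, by rw [ha]⟩
      · exact zero_mem _
  le_deg s hs γ := (X.le_deg s hs γ.2).trans (Nat.le_add_left _ _)

end Ext

namespace Res

variable {Z : Type*} [AddCommGroup Z] [Module R Z] {P : Res I m}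

/-- Iterated application of the operator to each coordinate. -/
theorem Op.cyc_pow {Y : Sys I Z} {f : R} (T : Op Y f) {N : Cx I} (l : ℕ) {n : ℤ} {x : N.Γ → Z}
    (hx : (N.tensor Y).Cyc n x) :
    (N.tensor Y).Cyc (n - 2 * l) (fun c => (T.t ^ l) (x c)) := by
  induction l with
  | zero => simpa using hx
  | succ l ih =>
    have h2 : (fun c => (T.t ^ (l + 1)) (x c)) = T.map N.Γ (fun c => (T.t ^ l) (x c)) := by
      funext c; rw [pow_succ']; rfl
    rw [h2]
    refine ⟨(N.tensor Y).cast (T.map_mem ih.1) (by push_cast; ring), ?_⟩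
    rw [← T.map_δ]
    exact (N.tensor Y).cast (T.map_mem ih.2) (by push_cast; ring)

theorem exists_ext (hP : P.Exact (I ^ 0) (I ^ 1) (I ^ 2)) (N : Cx I) {Y : Sys I Z}
    (hY : P.Good Y) (T : Op Y (P.φ P.e)) (l : ℕ) :
    ∃ (X : Ext N m) (H : X.E.Γ → N.Γ → R), (∀ γ c, H γ c ≠ 0 → X.E.deg γ + 2 * l = N.deg c) ∧
      ∀ n x, (N.tensor Y).Cyc n x → (X.E.tensor Y).Bd (n - 2 * l)
        (fun γ => (T.t ^ l) (X.push x γ) - act H x γ) := by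
  induction l with
  | zero =>
    refine ⟨Ext.refl m N, fun (γ c : N.Γ) => if γ = c then 1 else 0, fun γ c h => ?_,
      fun n x hx => ?_⟩
    · have : γ = c := by by_contra h'; exact h (if_neg h')
      subst this; rfl
    · refine Sys.Bd.of_mem (Cx.mem_tensor.2 fun γ => ?_)
      have h1 : (Ext.refl m N).push x γ = x γ := Ext.push_ι (X := Ext.refl m N) x γ
      have h2 : ∀ γ : N.Γ, act (fun γ c : N.Γ => if γ = c then (1 : R) else 0) x γ = x γ := by
        simp [act_apply]
      rw [h1, pow_zero, Module.End.one_apply]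
      exact (sub_eq_zero.2 (h2 γ).symm) ▸ zero_mem _
  | succ l ih =>
    obtain ⟨X, H, h1, h2⟩ := ih
    obtain ⟨h, g1, g2, g3⟩ := exists_step hP X.E hY T
    refine ⟨X.mul P, fun γ c => - ∑ d, h γ.1 γ.2 d * H d c, fun γ c hne => ?_,
      fun n x hx => ?_⟩
    · obtain ⟨d, -, hd⟩ := Finset.exists_ne_zero_of_sum_ne_zero (neg_ne_zero.1 hne)
      have e1 := h1 _ _ (right_ne_zero_of_mul hd)
      have e2 := g1 _ _ _ (left_ne_zero_of_mul hd)
      have e3 : (X.mul P).E.deg γ = P.deg γ.1 + X.E.deg γ.2 := rfl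
      omega
    · have a1 := g2 _ _ (T.cyc_pow l (X.push_cyc hx))
      have a2 := g3 _ _ (h2 _ _ hx)
      have a3 := a1.add a2.neg
      have e : n - 2 * ((l + 1 : ℕ) : ℤ) = n - 2 * l - 2 := by push_cast; ring
      rw [e]
      refine a3.of_eq (funext fun y => Eq.symm ?_)
      obtain ⟨a, γ⟩ : P.Γ × X.E.Γ := y
      have b1 : (X.mul P).push x (a, γ) = if a = P.e then X.push x γ else 0 := by
        by_cases ha : a = P.e
        · rw [if_pos ha, ha]
          by_cases hγ : γ ∈ Set.range X.ι
          · obtain ⟨c, rfl⟩ := hγ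
            rw [Ext.push_ι]
            exact Ext.push_ι (X := X.mul P) x c
          · rw [Ext.push_off _ hγ]
            refine Ext.push_off (X := X.mul P) x ?_
            rintro ⟨c, hc⟩
            exact hγ ⟨c, congrArg Prod.snd hc⟩
        · rw [if_neg ha]
          refine Ext.push_off (X := X.mul P) x ?_
          rintro ⟨c, hc⟩
          exact ha (congrArg Prod.fst hc).symm
      have b2 : act (fun (y : P.Γ × X.E.Γ) c => - ∑ d, h y.1 y.2 d * H d c) x (a, γ) =
          - act (h a) (act H x) γ := by
        rw [act_act]
        simp [act_apply]
      have b3 : act (h a) (fun γ => (T.t ^ l) (X.push x γ) - act H x γ) γ =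
          act (h a) (fun γ => (T.t ^ l) (X.push x γ)) γ - act (h a) (act H x) γ :=
        congrFun (map_sub (act (h a)) (fun γ => (T.t ^ l) (X.push x γ)) (act H x)) γ
      rw [b1]
      refine (congrArg (fun w => (T.t ^ (l + 1)) (if a = P.e then X.push x γ else 0) - w)
        b2).trans ?_
      change _ = ((if a = P.e then T.t ((T.t ^ l) (X.push x γ)) else 0) +
        act (h a) (fun γ => (T.t ^ l) (X.push x γ)) γ) +
        - act (h a) (fun γ => (T.t ^ l) (X.push x γ) - act H x γ) γ
      rw [b3]
      split_ifs
      · rw [pow_succ']; simp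
      · simp

end Res

end Core

section Core

variable {R : Type*} [CommRing R] {I m : Ideal R}

namespace Cx

variable {Z : Type*} [AddCommGroup Z] [Module R Z]

open Classical in
/-- The quotient complex on a set of cells closed under incidence. -/
noncomputable def restrict (N : Cx I) (U : Set N.Γ)
    (hU : ∀ c c', c ∈ U → N.A c c' ≠ 0 → c' ∈ U) : Cx I where
  Γ := U
  deg c := N.deg c
  A c c' := N.A c c'
  deg_eq c c' := N.deg_eq c c'
  sq c c'' := by
    convert N.sq c c'' using 1
    rw [← Finset.sum_subtype (Finset.univ.filter (· ∈ U)) (by simp)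
      (fun d => N.A c d * N.A d c'')]
    refine Finset.sum_filter_of_ne fun d _ h => hU c d c.2 (left_ne_zero_of_mul h)

theorem restrict_δ {N : Cx I} {U : Set N.Γ} (hU : ∀ c c', c ∈ U → N.A c c' ≠ 0 → c' ∈ U)
    (Y : Sys I Z) (v : N.Γ → Z) (c : N.Γ) (hc : c ∈ U) :
    ((N.restrict U hU).tensor Y).δ (fun u => v u.1) ⟨c, hc⟩ = (N.tensor Y).δ v c := by
  classical
  change ∑ d : U, N.A c d • v d + (-1 : R) ^ N.deg c • Y.δ (v c) =
    ∑ d, N.A c d • v d + (-1 : R) ^ N.deg c • Y.δ (v c)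
  congr 1
  refine Eq.trans ?_ (Finset.sum_filter_of_ne (p := (· ∈ U)) fun d _ h =>
    hU c d hc (left_ne_zero_of_smul h))
  rw [Finset.sum_subtype (Finset.univ.filter (· ∈ U)) (p := (· ∈ U)) (by simp)]

end Cx

namespace Res

variable {Z : Type*} [AddCommGroup Z] [Module R Z] {P : Res I m}

theorem Op.pow_mem {Y : Sys I Z} {f : R} (T : Op Y f) {N : Cx I} (l : ℕ) {j : ℕ} {n : ℤ}
    {x : N.Γ → Z} (hx : x ∈ (N.tensor Y).F j n) :
    (fun c => (T.t ^ l) (x c)) ∈ (N.tensor Y).F j (n - 2 * l) := by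
  induction l with
  | zero => simpa using hx
  | succ l ih =>
    have h2 : (fun c => (T.t ^ (l + 1)) (x c)) = T.map N.Γ (fun c => (T.t ^ l) (x c)) := by
      funext c
      rw [pow_succ']; rfl
    rw [h2]
    exact (N.tensor Y).cast (T.map_mem ih) (by push_cast; ring)

theorem Op.pow_δ {Y : Sys I Z} {f : R} (T : Op Y f) {N : Cx I} (l : ℕ) (x : N.Γ → Z) :
    (fun c => (T.t ^ l) ((N.tensor Y).δ x c)) = (N.tensor Y).δ (fun c => (T.t ^ l) (x c)) := by
  induction l with
  | zero => rfl
  | succ l ih =>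
    have h2 : ∀ y : N.Γ → Z, (fun c => (T.t ^ (l + 1)) (y c)) =
        T.map N.Γ (fun c => (T.t ^ l) (y c)) := fun y => by
      funext c
      rw [pow_succ']; rfl
    rw [h2, h2, ih, T.map_δ]

theorem exists_pow_bd_aux (hP : P.Exact (I ^ 0) (I ^ 1) (I ^ 2)) {Y : Sys I Z}
    (hY : P.Good Y) (T : Op Y (P.φ P.e)) (hneg : ∀ n < 0, Y.F 0 n = ⊥)
    (hm : ∀ a ∈ m, ∀ n y, Y.Cyc n y → Y.Bd n (a • y)) (k : ℕ) :
    ∀ (N : Cx I) (s : ℕ), (∀ c, s ≤ N.deg c) → ∃ M₀ : ℕ, ∀ M ≥ M₀, ∀ x,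
      (N.tensor Y).Cyc (k - 1 + s + 2 * M) x →
        (N.tensor Y).Bd (k - 1 + s) (fun c => (T.t ^ M) (x c)) := by
  classical
  induction k with
  | zero =>
    refine fun N s hs => ⟨0, fun M _ x hx => Sys.Bd.of_mem ?_⟩
    have h := (T.cyc_pow M hx).1
    refine Cx.mem_tensor.2 fun c => ?_
    have h1 := Cx.mem_tensor.1 h c
    rw [hneg _ (by have := hs c; push_cast; omega), Submodule.mem_bot] at h1
    rw [h1]; exact zero_mem _
  | succ k ih =>
    intro N s hs
    set l := ∑ c, N.deg c + 1 with hl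
    obtain ⟨X, H, hH, hX⟩ := exists_ext hP N hY T l
    have hH0 : H = 0 := by
      funext γ c
      by_contra h
      have h1 := hH γ c h
      have h2 := Finset.single_le_sum (f := N.deg) (fun _ _ => Nat.zero_le _) (Finset.mem_univ c)
      omega
    have hlt := X.le_deg s hs
    let U : Set X.E.Γ := {γ | γ ∉ Set.range X.ι ∧ s + 2 ≤ X.E.deg γ}
    have hU : ∀ c c', c ∈ U → X.E.A c c' ≠ 0 → c' ∈ U := by
      refine fun c c' hc h => ⟨?_, ?_⟩
      · rintro ⟨d, rfl⟩
        exact h (X.A_off _ _ hc.1)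
      · rw [X.E.deg_eq _ _ h]; have := hc.2; omega
    obtain ⟨M₁, hM₁⟩ := ih (X.E.restrict U hU) (s + 2) (fun c => c.2.2)
    refine ⟨M₁ + l, fun M hM x hx => ?_⟩
    obtain ⟨M', rfl⟩ : ∃ M', M = M' + l := ⟨M - l, by omega⟩
    obtain ⟨v, hv, hv'⟩ := hX _ _ hx
    have hv0 : (fun γ => (T.t ^ l) (X.push x γ)) - (X.E.tensor Y).δ v ∈
        (X.E.tensor Y).F 1 ((k : ℤ) + s + 2 * M') := by
      refine (X.E.tensor Y).cast ?_ (by push_cast; ring :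
        ((k + 1 : ℕ) : ℤ) - 1 + s + 2 * ((M' + l : ℕ) : ℤ) - 2 * l = _)
      convert hv' using 2
      funext γ
      simp [hH0, act_apply]
    have hv1 : v ∈ (X.E.tensor Y).F 0 ((k : ℤ) + 1 + s + 2 * M') :=
      (X.E.tensor Y).cast hv (by push_cast; ring)
    -- the part of `v` away from the original cells and in high degree is a boundary
    have hcyc : ((X.E.restrict U hU).tensor Y).Cyc ((k : ℤ) - 1 + (s + 2 : ℕ) + 2 * M')
        (fun u => v u.1) := by
      refine ⟨Cx.mem_tensor.2 fun u => Y.cast (Cx.mem_tensor.1 hv1 u.1) ?_,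
        Cx.mem_tensor.2 fun u => ?_⟩
      · change _ = _ - (X.E.deg u.1 : ℤ); push_cast; ring
      · have h1 := Cx.mem_tensor.1 hv0 u.1
        have h2 := Cx.restrict_δ hU Y v u.1 u.2
        rw [Pi.sub_apply, X.push_off _ u.2.1, map_zero, zero_sub, neg_mem_iff] at h1
        refine Y.cast (h2 ▸ h1) ?_
        change _ = _ - (X.E.deg u.1 : ℤ); push_cast; ring
    obtain ⟨q, hq, hq'⟩ := hM₁ M' (by omega) _ hcyc
    let q' : X.E.Γ → Z := fun γ => if h : γ ∈ U then q ⟨γ, h⟩ else 0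
    have hq1 : q' ∈ (X.E.tensor Y).F 0 ((k : ℤ) + s + 2) := by
      refine Cx.mem_tensor.2 fun γ => ?_
      by_cases h : γ ∈ U
      · simp only [q', dif_pos h]
        refine Y.cast (Cx.mem_tensor.1 hq ⟨γ, h⟩) ?_
        change _ - (X.E.deg γ : ℤ) = _; push_cast; ring
      · simp [q', h]
    have hqq : (fun u : U => q' u.1) = q := by
      funext u; exact dif_pos u.2
    let w : X.E.Γ → Z := (fun γ => (T.t ^ M') (v γ)) - (X.E.tensor Y).δ q'
    have hw : w ∈ (X.E.tensor Y).F 0 ((k : ℤ) + s + 1) :=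
      sub_mem ((X.E.tensor Y).cast (T.pow_mem M' hv1) (by ring))
        ((X.E.tensor Y).cast ((X.E.tensor Y).δ_mem _ _ _ hq1) (by ring))
    have hDw : X.push (fun c => (T.t ^ (M' + l)) (x c)) - (X.E.tensor Y).δ w ∈
        (X.E.tensor Y).F 1 ((k : ℤ) + s) := by
      have h1 := T.pow_mem M' hv0
      have h2 := (X.E.tensor Y).δδ _ _ hq1
      have h3 : X.push (fun c => (T.t ^ (M' + l)) (x c)) - (X.E.tensor Y).δ w =
          (fun γ => (T.t ^ M') (((fun γ => (T.t ^ l) (X.push x γ)) - (X.E.tensor Y).δ v) γ)) +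
            (X.E.tensor Y).δ ((X.E.tensor Y).δ q') := by
        have h4 : (fun γ => (T.t ^ M') (((fun γ => (T.t ^ l) (X.push x γ)) -
            (X.E.tensor Y).δ v) γ)) = X.push (fun c => (T.t ^ (M' + l)) (x c)) -
              (X.E.tensor Y).δ (fun γ => (T.t ^ M') (v γ)) := by
          rw [← T.pow_δ]
          funext γ
          simp only [Pi.sub_apply, map_sub, Ext.push, map_sum, pow_add, Module.End.mul_apply]
          congr 1
          refine Finset.sum_congr rfl fun c _ => ?_
          split_ifs <;> simp
        rw [h4, map_sub]; abel
      rw [h3]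
      exact add_mem ((X.E.tensor Y).cast h1 (by ring)) ((X.E.tensor Y).cast h2 (by ring))
    have hwU : ∀ γ ∈ U, w γ ∈ Y.F 1 ((k : ℤ) + s + 1 - X.E.deg γ) := by
      intro γ hγ
      have h2 : ((X.E.restrict U hU).tensor Y).δ q ⟨γ, hγ⟩ = (X.E.tensor Y).δ q' γ :=
        (congrArg (fun p => ((X.E.restrict U hU).tensor Y).δ p ⟨γ, hγ⟩) hqq.symm).trans
          (Cx.restrict_δ hU Y q' γ hγ)
      have h1 : (T.t ^ M') (v γ) - ((X.E.restrict U hU).tensor Y).δ q ⟨γ, hγ⟩ ∈ _ :=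
        Cx.mem_tensor.1 hq' ⟨γ, hγ⟩
      rw [h2] at h1
      refine Y.cast h1 ?_
      change _ - (X.E.deg γ : ℤ) = _; push_cast; ring
    have hwlow : ∀ γ, γ ∉ Set.range X.ι → X.E.deg γ = s + 1 → Y.Cyc k (w γ) := by
      intro γ hγ hd
      refine ⟨Y.cast (Cx.mem_tensor.1 hw γ) (by rw [hd]; push_cast; ring), ?_⟩
      have h1 := Cx.mem_tensor.1 hDw γ
      rw [Pi.sub_apply, X.push_off _ hγ, zero_sub, neg_mem_iff, Cx.tensor_δ, Cx.diff_apply] at h1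
      have h2 : act X.E.A w γ ∈ Y.F 1 ((k : ℤ) + s - X.E.deg γ) := by
        refine sum_mem fun γ' _ => ?_
        by_cases h : X.E.A γ γ' = 0
        · simp [h]
        have hd' := X.E.deg_eq _ _ h
        refine Submodule.smul_mem _ _ (Y.cast (hwU γ' ⟨?_, by omega⟩)
          (by rw [hd']; push_cast; ring))
        rintro ⟨c, rfl⟩
        exact h (X.A_off _ _ hγ)
      have h3 := Submodule.smul_mem _ ((-1 : R) ^ X.E.deg γ) ((Submodule.add_mem_iff_right _ h2).1 h1)
      rw [smul_smul, ← pow_add, Even.neg_one_pow ⟨_, rfl⟩, one_smul] at h3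
      exact Y.cast h3 (by rw [hd]; push_cast; ring)
    -- the contribution of the new cells is a boundary
    have hnew : ∀ c γ, γ ∉ Set.range X.ι → ∃ z ∈ Y.F 0 ((k : ℤ) + 1),
        (N.deg c ≠ s → z = 0) ∧ X.E.A (X.ι c) γ • w γ - Y.δ z ∈ Y.F 1 ((k : ℤ) + s - N.deg c) := by
      intro c γ hγ
      by_cases h : X.E.A (X.ι c) γ = 0
      · exact ⟨0, zero_mem _, fun _ => rfl, by simp [h]⟩
      have hd := X.E.deg_eq _ _ h
      rw [X.deg_ι] at hd
      by_cases hc : N.deg c = s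
      · obtain ⟨z, hz, hz'⟩ := hm _ (X.A_mem γ c hγ) _ _ (hwlow γ hγ (by omega))
        exact ⟨z, hz, fun h => absurd hc h, Y.cast hz' (by rw [hc]; ring)⟩
      · refine ⟨0, zero_mem _, fun _ => rfl, ?_⟩
        have := hs c
        rw [map_zero, sub_zero]
        exact Submodule.smul_mem _ _ (Y.cast (hwU γ ⟨hγ, by omega⟩)
          (by rw [hd]; push_cast; ring))
    choose! ζ hζ hζ0 hζ' using hnew
    let z : N.Γ → Z := fun c => ∑ γ ∈ Finset.univ.filter (· ∉ Set.range X.ι), ζ c γ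
    have hz0 : ∀ c, N.deg c ≠ s → z c = 0 := fun c hc =>
      Finset.sum_eq_zero fun γ hγ => hζ0 c γ (Finset.mem_filter.1 hγ).2 hc
    have hzδ : ∀ c, (N.tensor Y).δ ((-1 : R) ^ s • z) c = Y.δ (z c) := by
      intro c
      rw [Cx.tensor_δ, Cx.diff_apply]
      have : act N.A ((-1 : R) ^ s • z) c = 0 := Finset.sum_eq_zero fun d _ => by
        by_cases h : N.A c d = 0
        · simp [h]
        · have := N.deg_eq _ _ h
          have := hs c
          rw [Pi.smul_apply, hz0 d (by omega), smul_zero, smul_zero]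
      rw [this, zero_add]
      by_cases hc : N.deg c = s
      · rw [hc, Pi.smul_apply, map_smul, smul_smul, ← pow_add, Even.neg_one_pow ⟨_, rfl⟩, one_smul]
      · simp [hz0 c hc]
    refine ⟨(fun c => w (X.ι c)) + (-1 : R) ^ s • z, Cx.mem_tensor.2 fun c => ?_,
      Cx.mem_tensor.2 fun c => ?_⟩
    · refine add_mem (Y.cast (Cx.mem_tensor.1 hw (X.ι c)) ?_) ?_
      · rw [X.deg_ι]; push_cast; ring
      · rw [Pi.smul_apply]
        refine Submodule.smul_mem _ _ ?_
        by_cases hc : N.deg c = s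
        · exact Y.cast (sum_mem fun γ hγ => hζ c γ (Finset.mem_filter.1 hγ).2)
            (by rw [hc]; push_cast; ring)
        · rw [hz0 c hc]; exact zero_mem _
    · have h1 := Cx.mem_tensor.1 hDw (X.ι c)
      have h2 : (X.E.tensor Y).δ w (X.ι c) = (N.tensor Y).δ (fun c => w (X.ι c)) c +
          ∑ γ ∈ Finset.univ.filter (· ∉ Set.range X.ι), X.E.A (X.ι c) γ • w γ := by
        rw [Cx.tensor_δ, Cx.tensor_δ, Cx.diff_apply, Cx.diff_apply, X.deg_ι, act_apply, act_apply,
          ← Finset.sum_filter_add_sum_filter_not _ (· ∈ Set.range X.ι)]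
        have h3 : ∑ γ ∈ Finset.univ.filter (· ∈ Set.range X.ι), X.E.A (X.ι c) γ • w γ =
            ∑ d, N.A c d • w (X.ι d) := by
          symm
          refine Finset.sum_bij (fun d _ => X.ι d) (by simp) (fun _ _ _ _ h => X.inj h)
            (by simp) (by simp [X.A_ι])
        rw [h3]; abel
      rw [Pi.sub_apply, X.push_ι, h2, X.deg_ι] at h1
      have h4 : ∑ γ ∈ Finset.univ.filter (· ∉ Set.range X.ι), X.E.A (X.ι c) γ • w γ - Y.δ (z c) ∈
          Y.F 1 ((k : ℤ) + s - N.deg c) := by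
        rw [map_sum, ← Finset.sum_sub_distrib]
        exact sum_mem fun γ hγ => hζ' c γ (Finset.mem_filter.1 hγ).2
      refine Y.cast (m := (k : ℤ) + s - N.deg c) ?_ (by push_cast; ring)
      rw [Pi.sub_apply, map_add, Pi.add_apply, hzδ]
      convert add_mem h1 h4 using 1
      abel

/-- The complex with a single cell in degree zero. -/
def _root_.Vasconcelos.Cx.point (I : Ideal R) : Cx I where
  Γ := Unit
  deg _ := 0
  A _ _ := 0
  deg_eq _ _ h := absurd rfl h
  sq _ _ := by simp

theorem exists_pow_bd (hP : P.Exact (I ^ 0) (I ^ 1) (I ^ 2)) {Y : Sys I Z}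
    (hY : P.Good Y) (T : Op Y (P.φ P.e)) (hneg : ∀ n < 0, Y.F 0 n = ⊥)
    (hm : ∀ a ∈ m, ∀ n y, Y.Cyc n y → Y.Bd n (a • y)) (ρ : ℕ) :
    ∃ M₀ : ℕ, ∀ M ≥ M₀, ∀ x, Y.Cyc (ρ + 2 * M) x → Y.Bd ρ ((T.t ^ M) x) := by
  obtain ⟨M₀, h⟩ := exists_pow_bd_aux hP hY T hneg hm (ρ + 1) (Cx.point I) 0 (fun _ => Nat.zero_le _)
  have hδ : ∀ y c, ((Cx.point I).tensor Y).δ y c = Y.δ (y ()) := fun y c => by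
    change ∑ d : Unit, (0 : R) • y d + (-1 : R) ^ 0 • Y.δ (y ()) = _
    simp
  refine ⟨M₀, fun M hM x hx => ?_⟩
  have hx' : ((Cx.point I).tensor Y).Cyc (((ρ + 1 : ℕ) : ℤ) - 1 + (0 : ℕ) + 2 * M) (fun _ => x) :=
    ⟨Cx.mem_tensor.2 fun c => Y.cast hx.1 (by simp [Cx.point]),
      Cx.mem_tensor.2 fun c => (hδ (fun _ => x) c).symm ▸ Y.cast hx.2 (by simp [Cx.point])⟩
  obtain ⟨z, hz, hz'⟩ := h M hM _ hx'
  refine ⟨z (), Y.cast (Cx.mem_tensor.1 hz ()) (by simp [Cx.point]), ?_⟩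
  have e : (T.t ^ M) x - ((Cx.point I).tensor Y).δ z () = (T.t ^ M) x - Y.δ (z ()) :=
    congrArg ((T.t ^ M) x - ·) (hδ z ())
  have h1 : (T.t ^ M) x - ((Cx.point I).tensor Y).δ z () ∈
      Y.F 1 (((ρ + 1 : ℕ) : ℤ) - 1 + (0 : ℕ) - (0 : ℕ)) := Cx.mem_tensor.1 hz' ()
  exact Y.cast (e ▸ h1) (by simp)

end Res

end Core

section Core

variable {R : Type*} [CommRing R]

/-- Matrices lifting to `R` a free resolution over `R ⧸ (f)` of `R ⧸ m`, together with the
operator `t` measuring the failure of the lift to be a complex. -/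
structure Factor (f : R) (m : Ideal R) where
  b : ℕ → ℕ
  pos : 0 < b 0
  d : ∀ n, Fin (b n) → Fin (b (n + 1)) → R
  t : ∀ n, Fin (b n) → Fin (b (n + 2)) → R
  d_mem : ∀ i j, d 0 i j ∈ m
  exact_zero : ∀ y : Fin (b 0) → R, (∀ i, y i ∈ m) → ∃ x, act (d 0) x = y
  exact_succ : ∀ n (y : Fin (b (n + 1)) → R), (∀ i, f ∣ act (d n) y i) → ∃ x, act (d (n + 1)) x = y
  dd : ∀ n i k, ∑ j, d n i j * d (n + 1) j k = f * t n i k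
  td : ∀ n i k, ∑ j, t n i j * d (n + 2) j k = ∑ j, d n i j * t (n + 1) j k

theorem exists_act_iff {b : ℕ} [IsNoetherianRing R] (Q : Submodule R (Fin b → R)) :
    ∃ (k : ℕ) (D : Fin b → Fin k → R), ∀ y, y ∈ Q ↔ ∃ x, act D x = y := by
  obtain ⟨k, s, hs⟩ := Submodule.fg_iff_exists_fin_generating_family.1 (IsNoetherian.noetherian Q)
  refine ⟨k, fun i j => s j i, fun y => ?_⟩
  rw [← hs, Submodule.mem_span_range_iff_exists_fun]
  refine exists_congr fun c => ?_
  have : ∑ i, c i • s i = act (fun i j => s j i) c := by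
    ext i
    simp [act_apply, mul_comm]
  rw [this]

theorem act_single {Γ Γ' : Type*} [Fintype Γ] [DecidableEq Γ] (A : Γ' → Γ → R) (j : Γ) (i : Γ') :
    act A (Pi.single j (1 : R)) i = A i j := by
  simp [act_apply, Pi.single_apply]

theorem exists_factor [IsNoetherianRing R] {f : R} (hf : f ∈ nonZeroDivisors R) (m : Ideal R) :
    Nonempty (Factor f m) := by
  classical
  choose k D hD using fun (b : ℕ) (Q : Submodule R (Fin b → R)) => exists_act_iff Q
  let Q : ∀ (b b' : ℕ), (Fin b → Fin b' → R) → Submodule R (Fin b' → R) := fun b b' A =>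
    (Submodule.pi Set.univ fun _ => Ideal.span {f}).comap (act A)
  let step : (Σ (b : ℕ) (b' : ℕ), Fin b → Fin b' → R) → (Σ (b : ℕ) (b' : ℕ), Fin b → Fin b' → R) :=
    fun s => ⟨s.2.1, k _ (Q _ _ s.2.2), D _ (Q _ _ s.2.2)⟩
  let st : ℕ → Σ (b : ℕ) (b' : ℕ), Fin b → Fin b' → R := fun n =>
    Nat.rec ⟨1, k 1 (Submodule.pi Set.univ fun _ => m), D 1 (Submodule.pi Set.univ fun _ => m)⟩
      (fun _ s => step s) n
  let b : ℕ → ℕ := fun n => (st n).1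
  let d : ∀ n, Fin (b n) → Fin (b (n + 1)) → R := fun n => (st n).2.2
  have h0 : ∀ y : Fin (b 0) → R, (∀ i, y i ∈ m) ↔ ∃ x, act (d 0) x = y := fun y => by
    refine Iff.trans ?_ (hD 1 (Submodule.pi Set.univ fun _ => m) y)
    simp only [Submodule.mem_pi, Set.mem_univ, forall_const]
    rfl
  have h1 : ∀ n (y : Fin (b (n + 1)) → R), (∀ i, f ∣ act (d n) y i) ↔
      ∃ x, act (d (n + 1)) x = y := fun n y => by
    refine Iff.trans ?_ (hD _ (Q _ _ (st n).2.2) y)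
    simp only [Q, Submodule.mem_comap, Submodule.mem_pi, Set.mem_univ, forall_const,
      Ideal.mem_span_singleton]
    rfl
  have h2 : ∀ n i k, ∃ t, ∑ j, d n i j * d (n + 1) j k = f * t := fun n i k => by
    have := (h1 n (act (d (n + 1)) (Pi.single k 1))).2 ⟨_, rfl⟩ i
    rw [act_act, act_single] at this
    exact this
  choose t ht using h2
  refine ⟨⟨b, Nat.one_pos, d, t, fun i j => ?_, fun y => (h0 y).1, fun n y => (h1 n y).1, ht, ?_⟩⟩
  · rw [← act_single (d 0) j i]
    exact (h0 _).2 ⟨_, rfl⟩ i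
  · intro n i k
    refine (mul_cancel_left_mem_nonZeroDivisors hf).1 ?_
    rw [Finset.mul_sum, Finset.mul_sum]
    calc _ = ∑ j, ∑ l, d n i l * d (n + 1) l j * d (n + 2) j k := Finset.sum_congr rfl fun j _ => by
          rw [← mul_assoc, ← ht, Finset.sum_mul]
      _ = _ := by
          rw [Finset.sum_comm]
          refine Finset.sum_congr rfl fun j _ => ?_
          rw [mul_left_comm, ← ht, Finset.mul_sum]
          simp only [mul_assoc]

namespace Factor

variable {f : R} {m : Ideal R} (V : Factor f m) {Z Z' : Type*} [AddCommGroup Z] [Module R Z]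

theorem act_dd (n : ℕ) (x : Fin (V.b (n + 2)) → Z) :
    act (V.d n) (act (V.d (n + 1)) x) = f • act (V.t n) x := by
  rw [act_act]
  ext i
  simp only [act_apply, V.dd, Pi.smul_apply, Finset.smul_sum, smul_smul]

theorem act_td (n : ℕ) (x : Fin (V.b (n + 3)) → Z) :
    act (V.t n) (act (V.d (n + 2)) x) = act (V.d n) (act (V.t (n + 1)) x) := by
  rw [act_act, act_act]
  simp only [V.td]

theorem act_mem {Γ Γ' : Type*} [Fintype Γ] (A : Γ' → Γ → R) {J : Ideal R} {x : Γ → R}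
    (hx : ∀ i, x i ∈ J) (i : Γ') : act A x i ∈ J :=
  sum_mem fun _ _ => Ideal.mul_mem_left _ _ (hx _)

/-- The system attached to the lifted resolution. -/
noncomputable def sys (I : Ideal R) (hf : f ∈ I) : Sys I (∀ n, Fin (V.b n) → R) where
  F j n := Submodule.pi Set.univ fun k => Submodule.pi Set.univ fun _ =>
    if n = (k : ℤ) then I ^ j else ⊥
  le j n := Submodule.pi_mono fun k _ => Submodule.pi_mono fun _ _ => by
    split_ifs
    · exact Ideal.pow_le_pow_right (by omega)
    · exact le_rfl
  smul j n a x ha hx := by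
    simp only [Submodule.mem_pi, Set.mem_univ, forall_const] at *
    intro k i
    have := hx k i
    split_ifs at * with h
    · rw [pow_succ']; exact Ideal.mul_mem_mul ha this
    · simp at this; simp [this]
  δ := LinearMap.pi fun n => act (V.d n) ∘ₗ LinearMap.proj (n + 1)
  δ_mem j n x hx := by
    simp only [Submodule.mem_pi, Set.mem_univ, forall_const] at *
    intro k
    refine act_mem (V.d k) fun i => ?_
    have := hx (k + 1) i
    split_ifs at * with h1 h2 h2 <;> first | exact this | omega
  δδ n x hx := by
    simp only [Submodule.mem_pi, Set.mem_univ, forall_const] at *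
    intro k i
    change act (V.d k) (act (V.d (k + 1)) (x (k + 2))) i ∈ _
    rw [V.act_dd]
    have := hx (k + 2)
    split_ifs at * with h1 h2 h2 <;> try omega
    · simpa using I.mul_mem_right _ hf
    · have h3 : x (k + 2) = 0 := funext fun i => by simpa using this i
      simp [h3]

variable {I : Ideal R} (hf : f ∈ I)

theorem mem_sys {j : ℕ} {n : ℤ} {x : ∀ n, Fin (V.b n) → R} : x ∈ (V.sys I hf).F j n ↔
    ∀ (k : ℕ) i, x k i ∈ if n = (k : ℤ) then I ^ j else ⊥ := by
  simp [sys, Submodule.mem_pi]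

theorem sys_δ (x : ∀ n, Fin (V.b n) → R) (n : ℕ) :
    (V.sys I hf).δ x n = act (V.d n) (x (n + 1)) := rfl

theorem good_sys {P : Res I m} (h : P.Exact (I ^ 0) (I ^ 1) (I ^ 2)) : P.Good (V.sys I hf) :=
  fun n => Res.Exact.pi fun k => Res.Exact.pi fun i => by
    split_ifs
    · exact h
    · exact Res.Exact.bot

/-- The operator `t` on the associated system. -/
noncomputable def op : Res.Op (V.sys I hf) f where
  t := LinearMap.pi fun n => act (V.t n) ∘ₗ LinearMap.proj (n + 2)
  t_mem j n x hx := by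
    rw [mem_sys] at *
    intro k
    refine act_mem (V.t k) fun i => ?_
    have := hx (k + 2) i
    split_ifs at * with h1 h2 h2 <;> first | exact this | omega
  t_δ x := funext fun n => V.act_td n _
  δδ x := funext fun n => V.act_dd n _

end Factor

end Core

section Pd

variable (A : Type u) [CommRing A] (N : Type u) [AddCommGroup N] [Module A N]

/-- The module `N` has projective dimension less than `n`. -/
abbrev PdLT (n : ℕ) : Prop := HasProjectiveDimensionLT (ModuleCat.of A N) n

variable {A N}

theorem PdLT.mono {m n : ℕ} (h : PdLT A N m) (hmn : m ≤ n) : PdLT A N n :=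
  hasProjectiveDimensionLT_of_ge _ m n hmn

theorem PdLT.of_projective [Module.Projective A N] {n : ℕ} : PdLT A N (n + 1) := by
  have : Projective (ModuleCat.of A N) := (IsProjective.iff_projective N).1 inferInstance
  exact PdLT.mono (projective_iff_hasProjectiveDimensionLT_one.1 this) (by omega)

theorem PdLT.projective (h : PdLT A N 1) : Module.Projective A N :=
  (IsProjective.iff_projective N).2 (projective_iff_hasProjectiveDimensionLT_one.2 h)

theorem PdLT.subsingleton (h : PdLT A N 0) : Subsingleton N :=
  ModuleCat.subsingleton_of_isZero ((hasProjectiveDimensionLT_zero_iff_isZero _).1 h)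

variable {F : Type u} [AddCommGroup F] [Module A F]

theorem PdLT.of_equiv {n : ℕ} (h : PdLT A N n) (e : N ≃ₗ[A] F) : PdLT A F n :=
  hasProjectiveDimensionLT_of_iso e.toModuleIso n

theorem PdLT.of_ker {n : ℕ} {g : F →ₗ[A] N} (hg : Function.Surjective g)
    (h : PdLT A (LinearMap.ker g) n) (hF : PdLT A F (n + 1)) : PdLT A N (n + 1) :=
  (LinearMap.shortExact_shortComplexKer hg).hasProjectiveDimensionLT_X₃ n h hF

theorem PdLT.ker {n : ℕ} {g : F →ₗ[A] N} (hg : Function.Surjective g)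
    (hF : PdLT A F n) (h : PdLT A N (n + 1)) : PdLT A (LinearMap.ker g) n :=
  (LinearMap.shortExact_shortComplexKer hg).hasProjectiveDimensionLT_X₁ n hF h

end Pd

section Shift

variable {A : Type u} [CommRing A] {ι : ℕ → Type*} [∀ n, Fintype (ι n)]
  (D : ∀ n, ι n → ι (n + 1) → A) (N : Type*) [AddCommGroup N] [Module A N]

/-- Exactness, with coefficients in a module, of a sequence of matrices. -/
def ExactAt (j : ℕ) : Prop := ∀ x : ι (j + 1) → N, act (D j) x = 0 → ∃ z, act (D (j + 1)) z = x

variable {D N}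

theorem ExactAt.pi {κ : Type*} {j : ℕ} (h : ExactAt D N j) : ExactAt D (κ → N) j := by
  intro x hx
  choose z hz using fun k => h (fun i => x i k) (by
    ext i
    simpa [act_apply] using congrFun (congrFun hx i) k)
  refine ⟨fun i k => z k i, ?_⟩
  ext i k
  simpa [act_apply] using congrFun (hz k) i

variable {P : Type*} [AddCommGroup P] [Module A P]

theorem ExactAt.of_equiv {j : ℕ} (h : ExactAt D N j) (e : N ≃ₗ[A] P) : ExactAt D P j := by
  intro x hx
  obtain ⟨z, hz⟩ := h (fun i => e.symm (x i)) (funext fun i =>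
    (act_map _ e.symm.toLinearMap x i).trans (by simp [hx]))
  refine ⟨fun i => e (z i), funext fun i => (act_map _ e.toLinearMap z i).trans ?_⟩
  rw [hz]; exact e.apply_symm_apply _

variable (hD : ∀ j (x : ι (j + 2) → P), act (D j) (act (D (j + 1)) x) = 0) {g : P →ₗ[A] N}
  (hg : Function.Surjective g)

include hD hg

theorem ExactAt.of_ker {j : ℕ} (hP : ExactAt D P (j + 1)) (hK : ExactAt D (LinearMap.ker g) j) :
    ExactAt D N (j + 1) := by
  intro x hx
  choose y hy using fun i => hg (x i)
  obtain rfl : (fun i => g (y i)) = x := funext hy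
  have h1 : ∀ i, act (D (j + 1)) y i ∈ LinearMap.ker g := fun i => by
    rw [LinearMap.mem_ker, ← act_map, hx]; rfl
  obtain ⟨z, hz⟩ := hK (fun i => ⟨_, h1 i⟩) (funext fun i => Subtype.ext
    ((act_map _ (LinearMap.ker g).subtype _ i).symm.trans (congrFun (hD j y) i)))
  have h2 : act (D (j + 1)) (fun i => (z i : P)) = act (D (j + 1)) y := funext fun i =>
    (act_map _ (LinearMap.ker g).subtype z i).trans (congrArg Subtype.val (congrFun hz i))
  obtain ⟨w, hw⟩ := hP (y - fun i => (z i : P)) (by rw [map_sub, h2, sub_self])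
  refine ⟨fun i => g (w i), funext fun i => ?_⟩
  rw [act_map, hw, Pi.sub_apply, map_sub, (z i).2, sub_zero]

theorem ExactAt.ker {j : ℕ} (hP : ExactAt D P j) (hN : ExactAt D N (j + 1)) :
    ExactAt D (LinearMap.ker g) j := by
  intro x hx
  obtain ⟨w, hw⟩ := hP (fun i => (x i : P)) (funext fun i =>
    (act_map _ (LinearMap.ker g).subtype x i).trans (congrArg Subtype.val (congrFun hx i)))
  obtain ⟨z, hz⟩ := hN (fun i => g (w i)) (funext fun i => by
    rw [act_map, hw]; exact (x i).2)
  choose y hy using fun i => hg (z i)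
  obtain rfl : (fun i => g (y i)) = z := funext hy
  have h1 : ∀ i, (w - act (D (j + 2)) y) i ∈ LinearMap.ker g := fun i => by
    rw [LinearMap.mem_ker, Pi.sub_apply, map_sub, ← act_map, hz, sub_self]
  refine ⟨fun i => ⟨_, h1 i⟩, funext fun i => Subtype.ext
    ((act_map _ (LinearMap.ker g).subtype _ i).symm.trans ?_)⟩
  change act (D (j + 1)) (w - act (D (j + 2)) y) i = _
  rw [map_sub, hD, sub_zero, hw]

end Shift

section Local

variable {A : Type u} [CommRing A] [IsLocalRing A] [IsNoetherianRing A]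
  {N : Type u} [AddCommGroup N] [Module A N] [Module.Finite A N]

omit [IsNoetherianRing A] in
theorem PdLT.free (h : PdLT A N 1) : Module.Free A N :=
  have := h.projective
  Module.free_of_flat_of_isLocalRing

omit [IsLocalRing A] [IsNoetherianRing A] [Module.Finite A N] in
theorem one_tmul_eq_zero_iff (J : Ideal A) (x : N) :
    (1 : A ⧸ J) ⊗ₜ[A] x = 0 ↔ x ∈ J • (⊤ : Submodule A N) := by
  rw [← (TensorProduct.quotTensorEquivQuotSMul N J).map_eq_zero_iff,
    ← map_one (Ideal.Quotient.mk J), TensorProduct.quotTensorEquivQuotSMul_mk_tmul, one_smul,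
    Submodule.Quotient.mk_eq_zero]

omit [IsNoetherianRing A] [Module.Finite A N] in
theorem lTensor_residueField_injective (K : Submodule A N)
    (h : ∀ x : K, (x : N) ∈ IsLocalRing.maximalIdeal A • (⊤ : Submodule A N) →
      x ∈ IsLocalRing.maximalIdeal A • (⊤ : Submodule A K)) :
    Function.Injective (K.subtype.lTensor (IsLocalRing.ResidueField A)) := by
  rw [injective_iff_map_eq_zero]
  intro z hz
  obtain ⟨x, rfl⟩ := TensorProduct.mk_surjective A K (IsLocalRing.ResidueField A)
    IsLocalRing.residue_surjective z
  exact (one_tmul_eq_zero_iff (IsLocalRing.maximalIdeal A) x).2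
    (h x ((one_tmul_eq_zero_iff (IsLocalRing.maximalIdeal A) (x : N)).1 hz))

variable {ι : ℕ → Type*} [∀ n, Fintype (ι n)] {D : ∀ n, ι n → ι (n + 1) → A}
  (hD : ∀ i j k, ∑ l, D i j l * D (i + 1) l k = 0)
include hD

omit [IsLocalRing A] [IsNoetherianRing A] in
theorem act_eq_zero {P : Type*} [AddCommGroup P] [Module A P] (j) (x : ι (j + 2) → P) :
    act (D j) (act (D (j + 1)) x) = 0 := by
  rw [act_act]; ext i; simp [act_apply, hD]

theorem PdLT.exactAt (hA : ∀ j, ExactAt D A j) {n : ℕ} (h : PdLT A N (n + 1)) {j : ℕ}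
    (hj : n ≤ j) : ExactAt D N j := by
  induction n generalizing N j with
  | zero =>
    have := h.free
    exact ((hA j).pi (κ := Fin _)).of_equiv (Module.finBasis A N).equivFun.symm
  | succ n ih =>
    obtain ⟨k, g, hg⟩ := Module.Finite.exists_fin' A N
    obtain ⟨j, rfl⟩ : ∃ i, j = i + 1 := ⟨j - 1, by omega⟩
    exact ExactAt.of_ker (act_eq_zero hD) hg (hA _).pi
      (ih (PdLT.ker hg PdLT.of_projective h) (by omega))

theorem pdLT_of_exactAt [DecidableEq (ι 0)] (hA : ∀ j, ExactAt D A j) {n : ℕ} (hN : ExactAt D N n) (i₀ : ι 0)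
    (h0 : ∀ y : ι 0 → A, (∀ i, y i ∈ IsLocalRing.maximalIdeal A) → ∃ x, act (D 0) x = y)
    (hD0 : ∀ i j, D 0 i j ∈ IsLocalRing.maximalIdeal A) : PdLT A N (n + 1) := by
  obtain ⟨k, g, hg⟩ := Module.Finite.exists_fin' A N
  induction n generalizing N k with
  | zero =>
    suffices Module.Free A N from PdLT.of_projective
    refine Module.free_of_lTensor_residueField_injective (LinearMap.ker g).subtype g hg
      (fun x => by simp) (lTensor_residueField_injective _ fun x hx => ?_)
    have h1 : ∀ i, ∃ v : ι 1 → A, ∀ i', act (D 0) v i' = if i' = i₀ then (x : Fin k → A) i else 0 := by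
      intro i
      have h2 : (x : Fin k → A) i ∈ IsLocalRing.maximalIdeal A := by
        refine Submodule.smul_induction_on hx (fun a ha y _ => ?_) (fun y z hy hz => add_mem hy hz)
        exact Ideal.mul_mem_right _ _ ha
      obtain ⟨v, hv⟩ := h0 (fun i' => if i' = i₀ then (x : Fin k → A) i else 0) (fun i' => by
        split_ifs
        · exact h2
        · exact zero_mem _)
      exact ⟨v, congrFun hv⟩
    choose v hv using h1
    have hv' : ∀ i', act (D 0) (fun j i => v i j) i' = if i' = i₀ then (x : Fin k → A) else 0 := by
      intro i'
      ext i
      have := hv i i'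
      simp only [act_apply, Finset.sum_apply, Pi.smul_apply] at this ⊢
      rw [this]
      split_ifs <;> rfl
    obtain ⟨z, hz⟩ := hN (fun j => g fun i => v i j) (funext fun i' => by
      rw [act_map, hv']
      split_ifs
      · exact x.2
      · exact map_zero g)
    choose y hy using fun j => hg (z j)
    obtain rfl : (fun j => g (y j)) = z := funext hy
    have h3 : ∀ j, (fun i => v i j) - act (D 1) y j ∈ LinearMap.ker g := fun j => by
      rw [LinearMap.mem_ker, map_sub, ← act_map, hz, sub_self]
    have h4 : x = ∑ j, D 0 i₀ j • (⟨_, h3 j⟩ : LinearMap.ker g) := by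
      refine Subtype.ext ?_
      have h5 := congrFun (act_eq_zero hD 0 y) i₀
      have h6 := hv' i₀
      rw [if_pos rfl] at h6
      rw [act_apply] at h5 h6
      simp only [Submodule.coe_sum, Submodule.coe_smul, smul_sub, Finset.sum_sub_distrib, h5, h6]
      simp
    rw [h4]
    exact sum_mem fun j _ => Submodule.smul_mem_smul (hD0 _ _) trivial
  | succ n ih =>
    obtain ⟨l, g', hg'⟩ := Module.Finite.exists_fin' A (LinearMap.ker g)
    exact PdLT.of_ker hg (ih (ExactAt.ker (act_eq_zero hD) hg (hA _).pi hN) l g' hg') PdLT.of_projective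

end Local

section Core

variable {R : Type u} [CommRing R] {f : R} {m : Ideal R} (V : Factor f m)

namespace Factor

/-- The matrices of the mapping cone of the operator `t`, truncated to positive degrees. -/
noncomputable def cone (j : ℕ) : Fin (V.b (j + 1)) ⊕ Fin (V.b j) → Fin (V.b (j + 2)) ⊕ Fin (V.b (j + 1)) → R
  | .inl i, .inl k => V.d (j + 1) i k
  | .inl i, .inr k => if i = k then f else 0
  | .inr i, .inl k => - V.t j i k
  | .inr i, .inr k => - V.d j i k

theorem act_cone_inl {Z : Type*} [AddCommGroup Z] [Module R Z] (j : ℕ)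
    (x : Fin (V.b (j + 2)) ⊕ Fin (V.b (j + 1)) → Z) (i : Fin (V.b (j + 1))) :
    act (V.cone j) x (.inl i) =
      act (V.d (j + 1)) (fun i => x (.inl i)) i + f • x (.inr i) := by
  simp [act_apply, cone, ite_smul]

theorem act_cone_inr {Z : Type*} [AddCommGroup Z] [Module R Z] (j : ℕ)
    (x : Fin (V.b (j + 2)) ⊕ Fin (V.b (j + 1)) → Z) (i : Fin (V.b j)) :
    act (V.cone j) x (.inr i) =
      - act (V.t j) (fun i => x (.inl i)) i - act (V.d j) (fun i => x (.inr i)) i := by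
  simp [act_apply, cone, sub_eq_add_neg]

theorem cone_cone (j : ℕ) (i k) : ∑ l, V.cone j i l * V.cone (j + 1) l k = 0 := by
  rw [Fintype.sum_sum_type]
  rcases i with i | i <;> rcases k with k | k <;>
    simp only [cone, ite_mul, mul_ite, zero_mul, mul_zero, Finset.sum_ite_eq, Finset.sum_ite_eq',
      Finset.mem_univ, if_true, mul_neg, neg_mul, neg_neg, Finset.sum_neg_distrib, V.dd, V.td] <;>
    ring

theorem exactAt_cone (hf : f ∈ nonZeroDivisors R) (j : ℕ) : ExactAt V.cone R j := by
  intro x hx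
  have h1 : ∀ i, act (V.d (j + 1)) (fun i => x (.inl i)) i + f • x (.inr i) = 0 := fun i => by
    rw [← act_cone_inl, hx]; rfl
  obtain ⟨a, ha⟩ := V.exact_succ (j + 1) (fun i => x (.inl i)) fun i =>
    ⟨- x (.inr i), by rw [eq_neg_of_add_eq_zero_left (h1 i)]; simp⟩
  refine ⟨Sum.elim a 0, funext fun i => ?_⟩
  rcases i with i | i
  · rw [act_cone_inl]
    simpa using congrFun ha i
  · have h2 := h1 i
    rw [← ha, V.act_dd, Pi.smul_apply, ← smul_add] at h2
    have h3 := (mem_nonZeroDivisors_iff_left.1 hf) _ h2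
    rw [act_cone_inr]
    simp only [Sum.elim_inl, Sum.elim_inr]
    rw [show (fun _ => (0 : Fin (V.b (j + 2)) → R) _) = 0 from rfl, map_zero]
    simpa using (eq_neg_of_add_eq_zero_right h3).symm

variable {I : Ideal R} (hfI : f ∈ I)

theorem sys_neg (n : ℤ) (hn : n < 0) : (V.sys I hfI).F 0 n = ⊥ := by
  rw [eq_bot_iff]
  intro x hx
  rw [mem_sys] at hx
  refine funext fun k => funext fun i => ?_
  have := hx k i
  rwa [if_neg (by omega)] at this

theorem eq_single {n : ℕ} {x : ∀ n, Fin (V.b n) → R} (hx : x ∈ (V.sys I hfI).F 0 n) :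
    x = Pi.single n (x n) := by
  rw [mem_sys] at hx
  funext k
  by_cases h : k = n
  · subst h; simp
  · rw [Pi.single_eq_of_ne h]
    funext i
    have := hx k i
    rwa [if_neg (by omega)] at this

theorem single_mem {j n : ℕ} {v : Fin (V.b n) → R} (hv : ∀ i, v i ∈ I ^ j) :
    (Pi.single n v : ∀ n, Fin (V.b n) → R) ∈ (V.sys I hfI).F j n := by
  rw [mem_sys]
  intro k i
  by_cases h : k = n
  · subst h; simpa using hv i
  · rw [Pi.single_eq_of_ne h]; exact zero_mem _

theorem cyc_succ {n : ℕ} {v : Fin (V.b (n + 1)) → R} (hv : ∀ i, act (V.d n) v i ∈ I) :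
    (V.sys I hfI).Cyc ((n + 1 : ℕ) : ℤ) (Pi.single (n + 1) v) := by
  refine ⟨V.single_mem hfI (by simp), ?_⟩
  have : (V.sys I hfI).δ (Pi.single (n + 1) v) = Pi.single n (act (V.d n) v) := by
    funext k
    rw [sys_δ]
    by_cases h : k = n
    · subst h; simp
    · rw [Pi.single_eq_of_ne h, Pi.single_eq_of_ne (by omega), map_zero]
  rw [this]
  exact (V.sys I hfI).cast (V.single_mem hfI (by simpa using hv)) (by simp)

theorem Cyc.act_mem {n : ℕ} {x : ∀ n, Fin (V.b n) → R}
    (hx : (V.sys I hfI).Cyc ((n + 1 : ℕ) : ℤ) x) (i) : act (V.d n) (x (n + 1)) i ∈ I := by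
  have := (V.mem_sys hfI).1 hx.2 n i
  rw [if_pos (by simp), pow_one] at this
  exact this

theorem bd_of {n : ℕ} {v : ∀ n, Fin (V.b n) → R} (hv : v ∈ (V.sys I hfI).F 0 n)
    {c : Fin (V.b (n + 1)) → R}
    (hc : ∀ i, v n i - act (V.d n) c i ∈ I) : (V.sys I hfI).Bd n v := by
  refine ⟨Pi.single (n + 1) c, V.single_mem hfI (n := n + 1) (by simp), ?_⟩
  rw [mem_sys]
  intro k i
  rw [Pi.sub_apply, sys_δ]
  by_cases h : k = n
  · subst h
    simpa using hc i
  · rw [V.eq_single hfI hv, Pi.single_eq_of_ne h, Pi.single_eq_of_ne (by omega), map_zero, sub_zero]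
    exact zero_mem _

theorem Bd.exists {n : ℕ} {v : ∀ n, Fin (V.b n) → R} (hv : (V.sys I hfI).Bd n v) :
    ∃ c, ∀ i, v n i - act (V.d n) c i ∈ I := by
  obtain ⟨z, -, hz⟩ := hv
  refine ⟨z (n + 1), fun i => ?_⟩
  have := (V.mem_sys hfI).1 hz n i
  rwa [if_pos rfl, pow_one] at this

theorem exists_homotopy {a : R} (ha : a ∈ m) (n : ℕ) :
    ∃ σ : (Fin (V.b n) → R) →ₗ[R] (Fin (V.b (n + 1)) → R),
      (∀ (x : Fin (V.b (n + 1)) → R) i, f ∣ act (V.d n) (a • x - σ (act (V.d n) x)) i) ∧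
      ∀ y, (V.sys I hfI).Cyc n y → ∀ i, a * y n i - act (V.d n) (σ (y n)) i ∈ I := by
  induction n with
  | zero =>
    choose s hs using fun j => V.exact_zero (a • Pi.single j 1) fun i => by
      simpa using m.mul_mem_right _ ha
    have h1 : ∀ x, act (V.d 0) ((Pi.basisFun R _).constr R s x) = a • x := by
      intro x
      have : act (V.d 0) ∘ₗ (Pi.basisFun R _).constr R s = a • LinearMap.id :=
        (Pi.basisFun R _).ext fun j => by simp [hs]
      exact LinearMap.congr_fun this x
    refine ⟨(Pi.basisFun R _).constr R s, fun x i => ?_, fun y _ i => ?_⟩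
    · rw [map_sub, h1, map_smul, sub_self]
      simp
    · rw [h1]; simp
  | succ n ih =>
    obtain ⟨σ, h1, -⟩ := ih
    let g : (Fin (V.b (n + 1)) → R) →ₗ[R] (Fin (V.b (n + 1)) → R) :=
      a • LinearMap.id - σ ∘ₗ act (V.d n)
    choose s hs using fun j => V.exact_succ n (g (Pi.single j 1)) (h1 _)
    have h2 : ∀ x, act (V.d (n + 1)) ((Pi.basisFun R _).constr R s x) =
        a • x - σ (act (V.d n) x) := by
      intro x
      have : act (V.d (n + 1)) ∘ₗ (Pi.basisFun R _).constr R s = g :=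
        (Pi.basisFun R _).ext fun j => by simp [hs]
      exact LinearMap.congr_fun this x
    refine ⟨(Pi.basisFun R _).constr R s, fun x i => ?_, fun y hy i => ?_⟩
    · rw [map_sub, h2, map_smul, V.act_dd]
      simp
    · rw [h2]
      have h3 : ∀ i, act (V.d n) (y (n + 1)) i ∈ I := Cyc.act_mem V hfI hy
      rw [Pi.sub_apply, Pi.smul_apply, smul_eq_mul, sub_sub_cancel, σ.pi_apply_eq_sum_univ,
        Finset.sum_apply]
      exact sum_mem fun j _ => I.mul_mem_right _ (h3 j)

theorem smul_bd {a : R} (ha : a ∈ m) (n : ℤ) (y : ∀ n, Fin (V.b n) → R)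
    (hy : (V.sys I hfI).Cyc n y) : (V.sys I hfI).Bd n (a • y) := by
  rcases lt_or_ge n 0 with hn | hn
  · have := hy.1
    rw [V.sys_neg hfI n hn, Submodule.mem_bot] at this
    refine Sys.Bd.of_mem ?_
    rw [this, smul_zero]
    exact zero_mem _
  · lift n to ℕ using hn
    obtain ⟨σ, -, h⟩ := V.exists_homotopy hfI ha n
    exact V.bd_of hfI (Submodule.smul_mem _ _ hy.1) (h y hy)

variable {S : Type u} [CommRing S] [Algebra R S]

include hfI in
theorem exists_lift (hS : Function.Surjective (algebraMap R S))
    (hker : ∀ a : R, algebraMap R S a = 0 ↔ a ∈ I) {j : ℕ} (hE : ExactAt V.cone S j)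
    (y : Fin (V.b (j + 1)) → R) (hy : ∀ i, act (V.d j) y i ∈ I) :
    ∃ (a : Fin (V.b (j + 3)) → R) (c : Fin (V.b (j + 2)) → R),
      (∀ i, act (V.d (j + 2)) a i ∈ I) ∧
      ∀ i, y i - act (V.t (j + 1)) a i - act (V.d (j + 1)) c i ∈ I := by
  have hmap : ∀ {α β : Type} [Fintype β] (A : α → β → R) (x : β → R) i,
      act A (fun i => algebraMap R S (x i)) i = algebraMap R S (act A x i) := fun A x i =>
    act_map A (Algebra.linearMap R S) x i
  obtain ⟨z, hz⟩ := hE (Sum.elim 0 fun i => algebraMap R S (y i)) (funext fun i => by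
    rcases i with i | i
    · rw [act_cone_inl]
      change act (V.d (j + 1)) 0 i + f • algebraMap R S (y i) = 0
      rw [map_zero, Algebra.smul_def, (hker f).2 hfI, zero_mul]
      exact add_zero _
    · rw [act_cone_inr]
      change - act (V.t j) 0 i - act (V.d j) (fun i => algebraMap R S (y i)) i = 0
      rw [hmap, (hker _).2 (hy i), map_zero]
      simp)
  choose l hl using hS
  refine ⟨fun i => l (- z (.inl i)), fun i => l (- z (.inr i)), fun i => ?_, fun i => ?_⟩
  · rw [← hker, ← hmap]
    have := congrFun hz (.inl i)
    rw [act_cone_inl, Sum.elim_inl, Algebra.smul_def, (hker f).2 hfI, zero_mul, add_zero] at this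
    simp only [hl]
    refine (congrFun (map_neg (act (V.d (j + 2))) fun i => z (.inl i)) i).trans ?_
    rw [Pi.neg_apply, this]
    exact neg_zero
  · have := congrFun hz (.inr i)
    rw [act_cone_inr, Sum.elim_inr] at this
    rw [← hker, map_sub, map_sub, ← hmap, ← hmap, ← this]
    simp only [hl]
    have h1 := congrFun (map_neg (act (V.t (j + 1))) fun i => z (.inl i)) i
    have h2 := congrFun (map_neg (act (V.d (j + 1))) fun i => z (.inr i)) i
    refine (congrArg₂ (fun p q => _ - p - q) h1 h2).trans ?_
    rw [Pi.neg_apply, Pi.neg_apply]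
    ring

theorem exists_cyc (hS : Function.Surjective (algebraMap R S))
    (hker : ∀ a : R, algebraMap R S a = 0 ↔ a ∈ I) {j : ℕ} (hE : ExactAt V.cone S j)
    (y : ∀ n, Fin (V.b n) → R) (hy : (V.sys I hfI).Cyc ((j + 1 : ℕ) : ℤ) y) :
    ∃ a, (V.sys I hfI).Cyc ((j + 3 : ℕ) : ℤ) a ∧
      (V.sys I hfI).Bd ((j + 1 : ℕ) : ℤ) (y - (V.op hfI).t a) := by
  obtain ⟨a, c, h1, h2⟩ := V.exists_lift hfI hS hker hE (y (j + 1)) (Cyc.act_mem V hfI hy)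
  have h3 : (Pi.single (j + 3) a : ∀ n, Fin (V.b n) → R) (j + 3) = a := Pi.single_eq_same _ _
  refine ⟨_, V.cyc_succ hfI h1, V.bd_of hfI (sub_mem hy.1 ?_) (c := c) ?_⟩
  · refine (V.sys I hfI).cast ((V.op hfI).t_mem 0 _ _
      (V.single_mem hfI (n := j + 3) (by simp))) ?_
    push_cast; ring
  · intro i
    have h4 : (V.op hfI).t (Pi.single (j + 3) a) (j + 1) i = act (V.t (j + 1)) a i :=
      congrArg (fun v => act (V.t (j + 1)) v i) h3
    rw [Pi.sub_apply, Pi.sub_apply]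
    refine (congrArg (fun p => y (j + 1) i - p - act (V.d (j + 1)) c i ∈ I) h4).mpr (h2 i)

end Factor

end Core

theorem Res.Op.bd {R : Type*} [CommRing R] {I : Ideal R} {Z : Type*} [AddCommGroup Z] [Module R Z]
    {Y : Sys I Z} {f : R} (T : Res.Op Y f) {n : ℤ} {x : Z} (hx : Y.Bd (n + 2) x) :
    Y.Bd n (T.t x) := by
  obtain ⟨z, hz, h⟩ := hx
  refine ⟨T.t z, Y.cast (T.t_mem _ _ _ hz) (by ring), ?_⟩
  rw [← T.t_δ, ← map_sub]
  exact Y.cast (T.t_mem _ _ _ h) (by ring)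

section Core

variable {R : Type u} [CommRing R] {f : R} {m : Ideal R} (V : Factor f m)
  {I : Ideal R} (hfI : f ∈ I) {S : Type u} [CommRing S] [Algebra R S]

namespace Factor

theorem exists_cyc_pow (hS : Function.Surjective (algebraMap R S))
    (hker : ∀ a : R, algebraMap R S a = 0 ↔ a ∈ I) (M : ℕ) {j : ℕ}
    (hE : ∀ i, j ≤ i → ExactAt V.cone S i)
    (y : ∀ n, Fin (V.b n) → R) (hy : (V.sys I hfI).Cyc ((j + 1 : ℕ) : ℤ) y) :
    ∃ a, (V.sys I hfI).Cyc ((j + 1 : ℕ) + 2 * M) a ∧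
      (V.sys I hfI).Bd ((j + 1 : ℕ) : ℤ) (y - ((V.op hfI).t ^ M) a) := by
  induction M generalizing j y with
  | zero => exact ⟨y, by simpa using hy, Sys.Bd.of_mem (by simp)⟩
  | succ M ih =>
    obtain ⟨a, ha, hb⟩ := V.exists_cyc hfI hS hker (hE j le_rfl) y hy
    obtain ⟨a', ha', hb'⟩ := ih (j := j + 2) (fun i hi => hE i (by omega)) a ha
    refine ⟨a', ?_, ?_⟩
    · convert ha' using 1
      push_cast; ring
    · refine (hb.add ((V.op hfI).bd (n := (j + 1 : ℕ)) (x := a - ((V.op hfI).t ^ M) a') ?_)).of_eq ?_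
      · convert hb' using 1
        push_cast; ring
      · rw [map_sub, pow_succ', Module.End.mul_apply]
        abel

end Factor

variable [IsLocalRing R] [IsNoetherianRing R]

theorem pdLT_of_res (hf : f ∈ nonZeroDivisors R) (hfm : f ∈ IsLocalRing.maximalIdeal R)
    (hS : Function.Surjective (algebraMap R S))
    (hker : ∀ a : R, algebraMap R S a = 0 ↔ a ∈ I) {d : ℕ} (hpd : PdLT R S (d + 1))
    {P : Res I (IsLocalRing.maximalIdeal R)} (hP : P.Exact (I ^ 0) (I ^ 1) (I ^ 2))
    (hφ : P.φ P.e = f) (hfI : f ∈ I) {B : Type u} [CommRing B] [IsLocalRing B] [IsNoetherianRing B]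
    [Algebra R B] [Algebra B S] [IsScalarTower R B S] (hB : Function.Surjective (algebraMap R B))
    (hkB : ∀ a : R, algebraMap R B a = 0 ↔ f ∣ a) : PdLT B S (d + 1) := by
  obtain ⟨V⟩ := exists_factor hf (IsLocalRing.maximalIdeal R)
  have : Module.Finite R S := Module.Finite.of_surjective (Algebra.linearMap R S) hS
  have : Module.Finite B S := Module.Finite.of_restrictScalars_finite R B S
  have hE : ∀ i, d ≤ i → ExactAt V.cone S i := fun i hi =>
    PdLT.exactAt V.cone_cone (V.exactAt_cone hf) hpd hi
  subst hφ
  obtain ⟨M, hM⟩ := Res.exists_pow_bd hP (V.good_sys hfI hP) (V.op hfI)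
    (fun n hn => V.sys_neg hfI n hn) (fun a ha n y hy => V.smul_bd hfI ha n y hy) ((d + 1 : ℕ) : ℕ)
  have hbd : ∀ y, (V.sys I hfI).Cyc ((d + 1 : ℕ) : ℤ) y → (V.sys I hfI).Bd ((d + 1 : ℕ) : ℤ) y := by
    intro y hy
    obtain ⟨a, ha, hb⟩ := V.exists_cyc_pow hfI hS hker M hE y hy
    exact (hb.add (hM M le_rfl a ha)).of_eq (sub_add_cancel _ _)
  have hloc : IsLocalHom (algebraMap R B) := hB.isLocalHom
  have hmS : ∀ {α β : Type} [Fintype β] (A : α → β → R) (x : β → R) i,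
      act (fun i j => algebraMap R B (A i j)) (fun i => algebraMap R S (x i)) i =
        algebraMap R S (act A x i) := fun A x i => by
    simp only [act_apply, map_sum, Algebra.smul_def, map_mul,
      ← IsScalarTower.algebraMap_apply]
  have hmB : ∀ {α β : Type} [Fintype β] (A : α → β → R) (x : β → R) i,
      act (fun i j => algebraMap R B (A i j)) (fun i => algebraMap R B (x i)) i =
        algebraMap R B (act A x i) := fun A x i => by
    simp only [act_apply, map_sum, smul_eq_mul, map_mul]
  refine pdLT_of_exactAt (D := fun n i j => algebraMap R B (V.d n i j)) (fun i j k => ?_)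
    (fun j x hx => ?_) (n := d) (fun x hx => ?_) ⟨0, V.pos⟩ (fun y hy => ?_) (fun i j => ?_)
  · simp only [← map_mul, ← map_sum, V.dd]
    exact (hkB _).2 (dvd_mul_right _ _)
  · choose y hy using fun i => hB (x i)
    obtain rfl : (fun i => algebraMap R B (y i)) = x := funext hy
    obtain ⟨z, rfl⟩ := V.exact_succ j y fun i => by
      rw [← hkB, ← hmB, hx]; rfl
    exact ⟨fun i => algebraMap R B (z i), funext fun i => hmB _ _ _⟩
  · choose y hy using fun i => hS (x i)
    obtain rfl : (fun i => algebraMap R S (y i)) = x := funext hy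
    have h1 : ∀ i, act (V.d d) y i ∈ I := fun i => by
      rw [← hker, ← hmS, hx]; rfl
    obtain ⟨z, hz⟩ := Factor.Bd.exists V hfI (hbd _ (V.cyc_succ hfI h1))
    refine ⟨fun i => algebraMap R S (z i), funext fun i => (hmS _ _ _).trans ?_⟩
    have h2 : (Pi.single (d + 1) y : ∀ n, Fin (V.b n) → R) (d + 1) i = y i :=
      congrFun (Pi.single_eq_same _ _) i
    have h3 := (hker _).2 (hz i)
    rw [map_sub, sub_eq_zero] at h3
    exact h3.symm.trans (congrArg (algebraMap R S) h2)
  · choose x hx using fun i => hB (y i)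
    obtain rfl : (fun i => algebraMap R B (x i)) = y := funext hx
    obtain ⟨z, rfl⟩ := V.exact_zero x fun i => by
      have := hy i
      rwa [IsLocalRing.mem_maximalIdeal, map_mem_nonunits_iff] at this
    exact ⟨fun i => algebraMap R B (z i), funext fun i => hmB _ _ _⟩
  · rw [IsLocalRing.mem_maximalIdeal, map_mem_nonunits_iff]
    exact V.d_mem i j

end Core

section Resolution

variable {A : Type u} [CommRing A]

/-- A finite free resolution of `N`, in coordinates. -/
structure FRes (A : Type u) [CommRing A] (N : Type u) [AddCommGroup N] [Module A N] where
  Γ : Type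
  [fin : Fintype Γ]
  [dec : DecidableEq Γ]
  deg : Γ → ℕ
  mat : Γ → Γ → A
  aug : Γ → N
  deg_eq : ∀ c c', mat c c' ≠ 0 → deg c' = deg c + 1
  aug_deg : ∀ a, aug a ≠ 0 → deg a = 0
  sq : ∀ c c'', ∑ c', mat c c' * mat c' c'' = 0
  aug_mat : ∀ c, ∑ a, mat a c • aug a = 0
  surj : ∀ y, ∃ v : Γ → A, (∀ a, deg a ≠ 0 → v a = 0) ∧ ∑ a, v a • aug a = y
  zero : ∀ v : Γ → A, ∑ a, v a • aug a = 0 → ∃ w : Γ → A, (∀ a, deg a ≠ 1 → w a = 0) ∧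
    ∀ a, deg a = 0 → v a = act mat w a
  succ : ∀ i, ∀ v : Γ → A, (∀ a, deg a = i → act mat v a = 0) →
    ∃ w : Γ → A, (∀ a, deg a ≠ i + 2 → w a = 0) ∧ ∀ a, deg a = i + 1 → v a = act mat w a

attribute [instance] FRes.fin FRes.dec

namespace FRes

variable {N : Type u} [AddCommGroup N] [Module A N]

/-- The empty resolution of a zero module. -/
def ofSubsingleton [Subsingleton N] : FRes A N where
  Γ := Empty
  deg a := a.elim
  mat a := a.elim
  aug a := a.elim
  deg_eq a := a.elim
  aug_deg a := a.elim
  sq a := a.elim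
  aug_mat a := a.elim
  surj _ := ⟨fun a => a.elim, fun a => a.elim, Subsingleton.elim _ _⟩
  zero v _ := ⟨v, fun a => a.elim, fun a => a.elim⟩
  succ _ v _ := ⟨v, fun a => a.elim, fun a => a.elim⟩

variable {k : ℕ} {g : (Fin k → A) →ₗ[A] N} (Q : FRes A (LinearMap.ker g))

/-- The matrix of a resolution extended by one step. -/
def consMat : Fin k ⊕ Q.Γ → Fin k ⊕ Q.Γ → A
  | .inl c, .inr c' => (Q.aug c').1 c
  | .inr c, .inr c' => Q.mat c c'
  | _, .inl _ => 0

theorem act_consMat_inl (v : Fin k ⊕ Q.Γ → A) (c : Fin k) :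
    act Q.consMat v (.inl c) = (∑ a, v (.inr a) • Q.aug a).1 c := by
  simp [act_apply, consMat, mul_comm]

theorem act_consMat_inr (v : Fin k ⊕ Q.Γ → A) (c : Q.Γ) :
    act Q.consMat v (.inr c) = act Q.mat (fun a => v (.inr a)) c := by
  simp [act_apply, consMat]

theorem sum_single (v : Fin k → A) : ∑ i, v i • g (Pi.single i 1) = g v := by
  conv_rhs => rw [LinearMap.pi_apply_eq_sum_univ g v]
  refine Finset.sum_congr rfl fun i _ => congrArg (fun z => v i • g z) ?_
  ext j
  simp [Pi.single_apply, eq_comm]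

/-- Extend a resolution of the kernel of `g` to one of its target. -/
def cons (hg : Function.Surjective g) : FRes A N where
  Γ := Fin k ⊕ Q.Γ
  deg := Sum.elim (fun _ => 0) fun a => Q.deg a + 1
  mat := Q.consMat
  aug := Sum.elim (fun i => g (Pi.single i 1)) 0
  deg_eq
    | .inl c, .inr c', h => by
      have := Q.aug_deg c' fun h' => h (by simp [consMat, h'])
      simp [this]
    | .inr c, .inr c', h => by simp [Q.deg_eq c c' h]
    | .inl _, .inl _, h => (h rfl).elim
    | .inr _, .inl _, h => (h rfl).elim
  aug_deg
    | .inl c, _ => rfl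
    | .inr c, h => (h rfl).elim
  sq
    | .inl c, .inr c' => by
      have := congrFun (congrArg Subtype.val (Q.aug_mat c')) c
      simpa [consMat, mul_comm] using this
    | .inr c, .inr c' => by simpa [consMat] using Q.sq c c'
    | .inl c, .inl c' => by simp [consMat]
    | .inr c, .inl c' => by simp [consMat]
  aug_mat
    | .inl c => by simp [consMat]
    | .inr c => by
      have := (Q.aug c).2
      rw [LinearMap.mem_ker, ← sum_single] at this
      simpa [consMat] using this
  surj y := by
    obtain ⟨v, rfl⟩ := hg y
    refine ⟨Sum.elim v 0, ?_, ?_⟩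
    · rintro (a | a) h
      · exact (h rfl).elim
      · rfl
    · simp [sum_single]
  zero v hv := by
    have h1 : g (fun i => v (.inl i)) = 0 := by
      rw [← sum_single, ← hv]
      simp
    obtain ⟨w, hw, h⟩ := Q.surj ⟨_, h1⟩
    refine ⟨Sum.elim 0 w, ?_, ?_⟩
    · rintro (a | a) h
      · rfl
      · exact hw a (by simpa using h)
    · rintro (a | a) ha
      · rw [act_consMat_inl]
        simp [h]
      · simp at ha
  succ i v hv := by
    rcases i with - | i
    · obtain ⟨w, hw, h⟩ := Q.zero (fun a => v (.inr a)) (Subtype.ext (funext fun c => by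
        rw [← act_consMat_inl]; exact hv _ rfl))
      refine ⟨Sum.elim 0 w, ?_, ?_⟩
      · rintro (a | a) h
        · rfl
        · exact hw a (by simpa using h)
      · rintro (a | a) ha
        · simp at ha
        · rw [act_consMat_inr]
          exact h a (by simpa using ha)
    · obtain ⟨w, hw, h⟩ := Q.succ i (fun a => v (.inr a)) fun c hc => by
        rw [← act_consMat_inr]; exact hv _ (by simp [hc])
      refine ⟨Sum.elim 0 w, ?_, ?_⟩
      · rintro (a | a) h
        · rfl
        · exact hw a (by simpa using h)
      · rintro (a | a) ha
        · simp at ha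
        · rw [act_consMat_inr]
          exact h a (by simpa using ha)

end FRes

variable [IsLocalRing A] [IsNoetherianRing A]
  {N : Type u} [AddCommGroup N] [Module A N] [Module.Finite A N]

theorem PdLT.nonempty_fRes {n : ℕ} (h : PdLT A N n) : Nonempty (FRes A N) := by
  induction n generalizing N with
  | zero =>
    have := h.subsingleton
    exact ⟨.ofSubsingleton⟩
  | succ n ih =>
    rcases n with - | n
    · have := h.free
      let e := (Module.finBasis A N).equivFun.symm
      have : Subsingleton (LinearMap.ker e.toLinearMap) := by
        rw [LinearEquiv.ker]; infer_instance
      exact ⟨FRes.ofSubsingleton.cons (g := e.toLinearMap) e.surjective⟩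
    · obtain ⟨k, g, hg⟩ := Module.Finite.exists_fin' A N
      obtain ⟨Q⟩ := ih (PdLT.ker hg PdLT.of_projective h)
      exact ⟨Q.cons hg⟩

/-- A minimal generator can be completed to generators all of whose relations involve it with
coefficient in the maximal ideal. -/
theorem exists_surjective_of_not_mem {x : N}
    (hx : x ∉ IsLocalRing.maximalIdeal A • (⊤ : Submodule A N)) :
    ∃ (k : ℕ) (g : (Fin (k + 1) → A) →ₗ[A] N), Function.Surjective g ∧ g (Pi.single 0 1) = x ∧
      ∀ v ∈ LinearMap.ker g, v 0 ∈ IsLocalRing.maximalIdeal A := by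
  obtain ⟨l, hl⟩ := Module.Projective.exists_dual_eq_one (IsLocalRing.ResidueField A)
    (x := (1 : IsLocalRing.ResidueField A) ⊗ₜ[A] x)
    (fun h => hx ((one_tmul_eq_zero_iff (IsLocalRing.maximalIdeal A) x).1 h))
  let μ : N →ₗ[A] IsLocalRing.ResidueField A :=
    l.restrictScalars A ∘ₗ TensorProduct.mk A (IsLocalRing.ResidueField A) N 1
  have hμ : μ x = 1 := hl
  obtain ⟨k, h, hh⟩ := Module.Finite.exists_fin' A (LinearMap.ker μ)
  refine ⟨k, (LinearMap.proj 0).smulRight x + (LinearMap.ker μ).subtype ∘ₗ h ∘ₗ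
    LinearMap.funLeft A A Fin.succ, fun y => ?_, ?_, fun v hv => ?_⟩
  · obtain ⟨a, ha⟩ := IsLocalRing.residue_surjective (μ y)
    obtain ⟨w, hw⟩ := hh ⟨y - a • x, by
      rw [LinearMap.mem_ker, map_sub, map_smul, hμ, ← ha, Algebra.smul_def, mul_one]
      exact sub_self _⟩
    refine ⟨Fin.cons a w, ?_⟩
    have : LinearMap.funLeft A A Fin.succ (Fin.cons a w : Fin (k + 1) → A) = w := by
      ext i; simp [LinearMap.funLeft_apply]
    simp [this, hw]
  · have : LinearMap.funLeft A A Fin.succ (Pi.single 0 1 : Fin (k + 1) → A) = 0 := by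
      ext i; simp [LinearMap.funLeft_apply]
    simp [this]
  · have h1 := congrArg μ (LinearMap.mem_ker.1 hv)
    simp only [LinearMap.add_apply, map_add, LinearMap.smulRight_apply, LinearMap.proj_apply,
      LinearMap.comp_apply, Submodule.subtype_apply, LinearMap.map_coe_ker, map_smul, hμ,
      Algebra.smul_def, mul_one, add_zero, map_zero] at h1
    exact (IsLocalRing.residue_eq_zero_iff _).1 h1

theorem PdLT.exists_fRes {n : ℕ} (h : PdLT A N n) {x : N}
    (hx : x ∉ IsLocalRing.maximalIdeal A • (⊤ : Submodule A N)) :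
    ∃ (Q : FRes A N) (e : Q.Γ), Q.deg e = 0 ∧ Q.aug e = x ∧
      ∀ c, Q.mat e c ∈ IsLocalRing.maximalIdeal A := by
  obtain ⟨k, g, hg, hgx, hk⟩ := exists_surjective_of_not_mem hx
  obtain ⟨Q⟩ := (PdLT.ker (n := n + 1) hg PdLT.of_projective (h.mono (by omega))).nonempty_fRes
  refine ⟨Q.cons hg, .inl 0, rfl, hgx, ?_⟩
  rintro (c | c)
  · exact zero_mem _
  · exact hk _ (Q.aug c).2

end Resolution

section Lift

variable {R : Type u} [CommRing R] {I m : Ideal R} {S : Type u} [CommRing S] [Algebra R S]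
  {M : Type u} [AddCommGroup M] [Module S M]

theorem exists_res (hS : Function.Surjective (algebraMap R S))
    (hker : ∀ a : R, algebraMap R S a = 0 ↔ a ∈ I) (π : I →+ M)
    (hπ : ∀ (a : R) (x : I), π (a • x) = algebraMap R S a • π x)
    (hπs : Function.Surjective π) (hπk : ∀ x : I, π x = 0 ↔ (x : R) ∈ I ^ 2)
    (Q : FRes S M) (e : Q.Γ) (he : Q.deg e = 0) (f : I) (hf : Q.aug e = π f)
    (hm : ∀ (c : Q.Γ) (a : R), algebraMap R S a = Q.mat e c → a ∈ m) :
    ∃ P : Res I m, P.Exact (I ^ 0) (I ^ 1) (I ^ 2) ∧ P.φ P.e = f := by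
  classical
  obtain ⟨l, hl, hl0⟩ : ∃ l : S → R, (∀ s, algebraMap R S (l s) = s) ∧ l 0 = 0 := by
    choose l hl using hS
    refine ⟨fun s => if s = 0 then 0 else l s, fun s => ?_, by simp⟩
    dsimp only
    split_ifs with h <;> simp [h, hl]
  obtain ⟨φ, hφ, hφe, hφ0⟩ : ∃ φ : Q.Γ → I, (∀ a, π (φ a) = Q.aug a) ∧ φ e = f ∧
      ∀ a, Q.deg a ≠ 0 → φ a = 0 := by
    choose φ hφ using fun a => hπs (Q.aug a)
    refine ⟨fun a => if a = e then f else if Q.deg a = 0 then φ a else 0, fun a => ?_, by simp,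
      fun a ha => ?_⟩
    · dsimp only
      split_ifs with h1 h2
      · rw [h1, hf]
      · exact hφ a
      · rw [map_zero]
        by_contra h
        exact h2 (Q.aug_deg a (Ne.symm h))
    · have : a ≠ e := fun h => ha (by rw [h, he])
      simp [this, ha]
  have hsum : ∀ v : Q.Γ → R, π (∑ a, v a • φ a) = ∑ a, algebraMap R S (v a) • Q.aug a := fun v => by
    simp only [map_sum, hπ, hφ]
  have hco : ∀ v : Q.Γ → R, ((∑ a, v a • φ a : I) : R) = ∑ a, (φ a : R) • v a := fun v => by
    simp [mul_comm]
  have hact : ∀ (v : Q.Γ → R) c, algebraMap R S (act (fun i j => l (Q.mat i j)) v c) =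
      act Q.mat (fun i => algebraMap R S (v i)) c := fun v c => by
    simp [act_apply, hl]
  refine ⟨{ Γ := Q.Γ, deg := Q.deg, A := fun i j => l (Q.mat i j), deg_eq := fun c c' h => ?_,
            sq := fun c c'' => ?_, φ := fun a => φ a, φ_deg := fun a h => ?_, e := e,
            deg_e := he, A_e := fun c => hm c _ (hl _) },
    ⟨fun y hy => ?_, fun v _ hv => ?_, fun i v _ hv => ?_⟩, congrArg Subtype.val hφe⟩
  · exact Q.deg_eq c c' fun h' => h (by rw [h', hl0])
  · rw [← hker, map_sum]
    simp only [map_mul, hl]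
    exact Q.sq c c''
  · by_contra h'
    exact h (by rw [hφ0 a h']; rfl)
  · rw [pow_one] at hy
    obtain ⟨v, hv0, hv⟩ := Q.surj (π ⟨y, hy⟩)
    refine ⟨fun a => l (v a), by simp, fun a ha => (congrArg l (hv0 a ha)).trans hl0, ?_⟩
    have h1 : π (⟨y, hy⟩ - ∑ a, l (v a) • φ a) = 0 := by
      rw [map_sub, hsum, ← hv]
      simp [hl]
    have h2 := (hπk _).1 h1
    rw [Submodule.coe_sub, hco] at h2
    exact h2
  · change ∑ a, (φ a : R) • v a ∈ I ^ 2 at hv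
    rw [← hco, ← hπk, hsum] at hv
    obtain ⟨w, hw0, hw⟩ := Q.zero _ hv
    refine ⟨fun a => l (w a), by simp, fun a ha => (congrArg l (hw0 a ha)).trans hl0, fun a ha => ?_⟩
    rw [pow_one, ← hker, map_sub, hw a ha]
    refine sub_eq_zero.2 (Eq.symm ((hact _ a).trans ?_))
    simp only [hl]
  · obtain ⟨w, hw0, hw⟩ := Q.succ i (fun a => algebraMap R S (v a)) fun a ha => by
      have := hv a ha
      rw [pow_one, ← hker] at this
      exact (hact v a).symm.trans this
    refine ⟨fun a => l (w a), by simp, fun a ha => (congrArg l (hw0 a ha)).trans hl0, fun a ha => ?_⟩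
    rw [pow_one, ← hker, map_sub, hw a ha]
    refine sub_eq_zero.2 (Eq.symm ((hact _ a).trans ?_))
    simp only [hl]

end Lift

section DepthZero

variable {A : Type u} [CommRing A] [IsLocalRing A]
  {N : Type u} [AddCommGroup N] [Module A N] [Module.Finite A N]

omit [Module.Finite A N] in
theorem mem_smul_top_of_smul_eq_zero [Module.Free A N] {s : A} (hs : s ≠ 0) {x : N}
    (hx : s • x = 0) : x ∈ IsLocalRing.maximalIdeal A • (⊤ : Submodule A N) := by
  let b := Module.Free.chooseBasis A N
  rw [← b.linearCombination_repr x, Finsupp.linearCombination_apply]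
  refine sum_mem fun i _ => Submodule.smul_mem_smul ?_ trivial
  have h : s * b.repr x i = 0 := by
    simpa using DFunLike.congr_fun (congrArg b.repr hx) i
  exact fun h' => hs (h'.mul_left_eq_zero.1 h)

theorem PdLT.free_of_socle [IsNoetherianRing A] {s : A} (hs : s ≠ 0)
    (hms : ∀ a ∈ IsLocalRing.maximalIdeal A, a * s = 0) {n : ℕ} (h : PdLT A N n) :
    Module.Free A N := by
  induction n generalizing N with
  | zero => exact (h.mono (Nat.zero_le 1)).free
  | succ n ih =>
    rcases n with - | n
    · exact h.free
    · obtain ⟨k, g, hg⟩ := Module.Finite.exists_fin' A N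
      have := ih (PdLT.ker hg PdLT.of_projective h)
      refine Module.free_of_lTensor_residueField_injective (LinearMap.ker g).subtype g hg
        (fun x => by simp) (lTensor_residueField_injective _ fun x hx => ?_)
      refine mem_smul_top_of_smul_eq_zero hs (Subtype.ext (funext fun i => ?_))
      change s * (x : Fin k → A) i = 0
      rw [mul_comm]
      refine hms _ ?_
      refine Submodule.smul_induction_on hx (fun a ha y _ => ?_) (fun y z hy hz => add_mem hy hz)
      exact Ideal.mul_mem_right _ _ ha

end DepthZero

section Localize

variable {A : Type u} [CommRing A] {N : Type u} [AddCommGroup N] [Module A N]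

theorem PdLT.localized {n : ℕ} (h : PdLT A N n) (T : Submonoid A) :
    PdLT (Localization T) (LocalizedModule T N) (n + 1) := by
  have : HasProjectiveDimensionLE (ModuleCat.of A N) n := h.mono (Nat.le_succ n)
  have := ModuleCat.localizedModule_hasProjectiveDimensionLE n T (ModuleCat.of A N)
  exact PdLT.of_equiv (N := Shrink.{u} (LocalizedModule T N)) this (Shrink.linearEquiv _ _)

variable {p : Ideal A} [p.IsPrime] {s : A} (hs : ∀ a, a ∈ p ↔ a * s = 0)
include hs

theorem algebraMap_ne_zero_of_ann : algebraMap A (Localization.AtPrime p) s ≠ 0 := by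
  rw [Ne, IsLocalization.map_eq_zero_iff p.primeCompl]
  rintro ⟨⟨t, ht⟩, h⟩
  exact ht ((hs t).2 h)

theorem mul_algebraMap_eq_zero_of_ann (a : Localization.AtPrime p)
    (ha : a ∈ IsLocalRing.maximalIdeal (Localization.AtPrime p)) :
    a * algebraMap A (Localization.AtPrime p) s = 0 := by
  obtain ⟨⟨x, t⟩, h⟩ := IsLocalization.surj p.primeCompl a
  have hx : x ∈ p := by
    rw [← IsLocalization.AtPrime.to_map_mem_maximal_iff (Localization.AtPrime p) p]
    rw [← h]
    exact Ideal.mul_mem_right _ _ ha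
  have h2 : a * algebraMap A (Localization.AtPrime p) s * algebraMap A _ (t : A) = 0 := by
    rw [mul_right_comm, h, ← map_mul, (hs x).1 hx, map_zero]
  exact (IsUnit.mul_left_eq_zero (IsLocalization.map_units _ t)).1 h2

variable [IsNoetherianRing A] [Module.Finite A N]

theorem PdLT.free_localized {n : ℕ} (h : PdLT A N n) :
    Module.Free (Localization.AtPrime p) (LocalizedModule p.primeCompl N) :=
  have : IsNoetherianRing (Localization.AtPrime p) :=
    IsLocalization.isNoetherianRing p.primeCompl _ inferInstance
  PdLT.free_of_socle (algebraMap_ne_zero_of_ann hs) (mul_algebraMap_eq_zero_of_ann hs)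
    (h.localized p.primeCompl)

omit hs [IsNoetherianRing A] [Module.Finite A N] in
theorem exists_smul_mem_of_localized {x : N}
    (hx : LocalizedModule.mkLinearMap p.primeCompl N x ∈
      IsLocalRing.maximalIdeal (Localization.AtPrime p) •
        (⊤ : Submodule (Localization.AtPrime p) (LocalizedModule p.primeCompl N))) :
    ∃ t ∉ p, t • x ∈ p • (⊤ : Submodule A N) := by
  have key : ∀ z ∈ IsLocalRing.maximalIdeal (Localization.AtPrime p) •
        (⊤ : Submodule (Localization.AtPrime p) (LocalizedModule p.primeCompl N)),
      ∃ t ∉ p, ∃ y ∈ p • (⊤ : Submodule A N), t • z = LocalizedModule.mkLinearMap p.primeCompl N y := by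
    intro z hz
    refine Submodule.smul_induction_on hz (fun a ha y _ => ?_) ?_
    · obtain ⟨⟨b, t⟩, h⟩ := IsLocalization.surj p.primeCompl a
      obtain ⟨⟨y', t'⟩, h'⟩ := IsLocalizedModule.surj p.primeCompl
        (LocalizedModule.mkLinearMap p.primeCompl N) y
      have hb : b ∈ p := by
        rw [← IsLocalization.AtPrime.to_map_mem_maximal_iff (Localization.AtPrime p) p, ← h]
        exact Ideal.mul_mem_right _ _ ha
      refine ⟨t * t', (t * t').2, b • y', Submodule.smul_mem_smul hb trivial, ?_⟩
      rw [map_smul, ← h', mul_smul, ← algebraMap_smul (Localization.AtPrime p) b, ← h]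
      simp only [Submonoid.smul_def]
      rw [smul_comm (t' : A) a y, mul_comm, mul_smul, algebraMap_smul]
    · rintro z w ⟨t, ht, y, hy, h⟩ ⟨t', ht', y', hy', h'⟩
      refine ⟨t * t', (p.primeCompl.mul_mem ht ht' :), t' • y + t • y',
        add_mem (Submodule.smul_mem _ _ hy) (Submodule.smul_mem _ _ hy'), ?_⟩
      rw [smul_add, map_add, map_smul, map_smul, ← h, ← h', mul_smul, mul_smul, smul_comm t t']
  obtain ⟨t, ht, y, hy, h⟩ := key _ hx
  rw [← map_smul, IsLocalizedModule.eq_iff_exists p.primeCompl] at h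
  obtain ⟨⟨c, hc⟩, h⟩ := h
  refine ⟨c * t, (p.primeCompl.mul_mem hc ht :), ?_⟩
  rw [mul_smul]
  change c • t • x = c • y at h
  rw [h]
  exact Submodule.smul_mem _ _ hy

end Localize

section Rank

variable {A : Type u} [CommRing A] [IsLocalRing A] [IsNoetherianRing A]

omit [IsLocalRing A] in
theorem exists_ann_prime {J : Ideal A} (hJ : J ≠ ⊥) :
    ∃ (p : Ideal A) (s : A), p.IsPrime ∧ s ∈ J ∧ ∀ a, a ∈ p ↔ a * s = 0 := by
  have : Nontrivial J := Submodule.nontrivial_iff_ne_bot.2 hJ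
  obtain ⟨p, hp⟩ := associatedPrimes.nonempty A J
  obtain ⟨hp, s, hs⟩ := isAssociatedPrime_iff.1 hp
  refine ⟨p, s, hp, s.2, fun a => ?_⟩
  rw [hs, Submodule.mem_colon_singleton, Submodule.mem_bot, ← Subtype.coe_inj]
  rfl

omit [IsLocalRing A] in
theorem PdLT.eq_zero_of_smul_eq_zero {N : Type u} [AddCommGroup N] [Module A N]
    [Module.Finite A N] {n : ℕ} (h : PdLT A N n) {x : N}
    (hx : ∀ (p : Ideal A) (s : A), p.IsPrime → (∀ a, a ∈ p ↔ a * s = 0) → ∀ t ∉ p,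
      t • x ∉ p • (⊤ : Submodule A N)) {a : A} (ha : a • x = 0) : a = 0 := by
  by_contra h0
  have hJ : LinearMap.ker (LinearMap.toSpanSingleton A N x) ≠ ⊥ := fun h' => h0 (by
    rw [← Submodule.mem_bot A, ← h']; simpa using ha)
  obtain ⟨p, s, hp, hsJ, hs⟩ := exists_ann_prime hJ
  have := h.free_localized hs
  obtain ⟨t, ht, htx⟩ := exists_smul_mem_of_localized (p := p) (x := x)
    (mem_smul_top_of_smul_eq_zero (algebraMap_ne_zero_of_ann hs) (by
      rw [algebraMap_smul, ← map_smul]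
      have : s • x = 0 := by simpa using hsJ
      rw [this, map_zero]))
  exact hx p s hp hs t ht htx

theorem finrank_eq_add_of_exact {B L M N : Type*} [CommRing B] [Nontrivial B] [AddCommMonoid L]
    [AddCommMonoid M] [AddCommMonoid N] [Module B L] [Module B M] [Module B N]
    [Module.Free B L] [Module.Finite B L] [Module.Free B N] [Module.Finite B N]
    {f : L →ₗ[B] M} {g : M →ₗ[B] N} (h : Function.Exact f g) (hf : Function.Injective f)
    (hg : Function.Surjective g) :
    Module.finrank B M = Module.finrank B L + Module.finrank B N := by
  let _ := Module.addCommMonoidToAddCommGroup B (M := L)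
  let _ := Module.addCommMonoidToAddCommGroup B (M := M)
  let _ := Module.addCommMonoidToAddCommGroup B (M := N)
  obtain ⟨l, hl⟩ := Module.projective_lifting_property g LinearMap.id hg
  obtain ⟨e, -⟩ := h.splitSurjectiveEquiv hf ⟨l, hl⟩
  rw [e.finrank_eq, Module.finrank_prod]

theorem PdLT.exists_finrank {N : Type u} [AddCommGroup N] [Module A N]
    [Module.Finite A N] {n : ℕ} (h : PdLT A N n) : ∃ r : ℕ,
    ∀ (p : Ideal A) [p.IsPrime] (s : A), (∀ a, a ∈ p ↔ a * s = 0) →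
      Module.finrank (Localization.AtPrime p) (LocalizedModule p.primeCompl N) = r := by
  induction n generalizing N with
  | zero =>
    have := h.subsingleton
    refine ⟨0, fun p _ s hs => ?_⟩
    exact Module.finrank_zero_of_subsingleton
  | succ n ih =>
    rcases n with - | n
    · have := h.free
      refine ⟨Module.finrank A N, fun p _ s hs => ?_⟩
      exact Module.finrank_of_isLocalizedModule_of_free _ p.primeCompl
        (LocalizedModule.mkLinearMap p.primeCompl N)
    · obtain ⟨k, g, hg⟩ := Module.Finite.exists_fin' A N
      have hK := PdLT.ker hg PdLT.of_projective h
      obtain ⟨r, hr⟩ := ih hK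
      refine ⟨k - r, fun p _ s hs => ?_⟩
      have h1 := h.free_localized hs
      have h2 := hK.free_localized hs
      have hex : Function.Exact (LinearMap.ker g).subtype g := fun x => by simp
      let m : LocalizedModule p.primeCompl (LinearMap.ker g) →ₗ[Localization.AtPrime p]
        LocalizedModule p.primeCompl (Fin k → A) :=
          LocalizedModule.map p.primeCompl (LinearMap.ker g).subtype
      let m' : LocalizedModule p.primeCompl (Fin k → A) →ₗ[Localization.AtPrime p]
        LocalizedModule p.primeCompl N := LocalizedModule.map p.primeCompl g
      have h3 : Function.Exact m m' := LocalizedModule.map_exact p.primeCompl _ _ hex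
      have h4 : Function.Surjective m' := LocalizedModule.map_surjective p.primeCompl g hg
      have h5 : Function.Injective m := LocalizedModule.map_injective p.primeCompl _
        (Submodule.injective_subtype _)
      have h6 := finrank_eq_add_of_exact h3 h5 h4
      rw [hr p s hs, Module.finrank_of_isLocalizedModule_of_free
        (Localization.AtPrime p) p.primeCompl
        (LocalizedModule.mkLinearMap p.primeCompl (Fin k → A)), Module.finrank_fin_fun] at h6
      omega

theorem exists_nonZeroDivisor_mem {I : Ideal A} (hI0 : I ≠ ⊥) {n : ℕ}
    (h : PdLT A (A ⧸ I) n) : ∃ f ∈ I, f ∈ nonZeroDivisors A := by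
  by_contra! hc
  obtain ⟨q, hq, hIq⟩ : ∃ q ∈ associatedPrimes A A, I ≤ q := by
    refine (Ideal.subset_union_prime_finite (associatedPrimes.finite A A) (f := id) ⊥ ⊥
      (fun p hp _ _ => hp.1)).1 fun x hx => ?_
    have := biUnion_associatedPrimes_eq_compl_nonZeroDivisors A
    exact this.symm ▸ hc x hx
  obtain ⟨hqp, s, hs⟩ := isAssociatedPrime_iff.1 hq
  have hs : ∀ a, a ∈ q ↔ a * s = 0 := fun a => by
    rw [hs, Submodule.mem_colon_singleton, Submodule.mem_bot]; rfl
  obtain ⟨r, hr⟩ := h.exists_finrank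
  obtain ⟨p, s', hp, hsI, hs'⟩ := exists_ann_prime hI0
  have h1 := h.free_localized hs
  have h2 := h.free_localized hs'
  have h3 : Nontrivial (LocalizedModule q.primeCompl (A ⧸ I)) := by
    refine ⟨LocalizedModule.mkLinearMap q.primeCompl (A ⧸ I) 1, 0, fun h0 => ?_⟩
    rw [IsLocalizedModule.eq_zero_iff q.primeCompl] at h0
    obtain ⟨⟨t, ht⟩, h0⟩ := h0
    refine ht (hIq ?_)
    rw [← Ideal.Quotient.eq_zero_iff_mem, ← h0]
    change _ = Ideal.Quotient.mk I (t * 1)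
    rw [mul_one]
  have h4 : 0 < r := by
    rw [← hr q s hs]
    rw [Module.finrank_eq_card_chooseBasisIndex]
    have := (Module.Free.chooseBasis (Localization.AtPrime q)
      (LocalizedModule q.primeCompl (A ⧸ I))).index_nonempty
    exact Fintype.card_pos
  have h5 : Nontrivial (LocalizedModule p.primeCompl (A ⧸ I)) := by
    apply Module.nontrivial_of_finrank_pos (R := Localization.AtPrime p)
    rw [hr p s' hs']
    exact h4
  refine algebraMap_ne_zero_of_ann hs' ?_
  have h6 : ∀ z : LocalizedModule p.primeCompl (A ⧸ I),
      algebraMap A (Localization.AtPrime p) s' • z = 0 := fun z => by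
    induction z using LocalizedModule.induction_on with
    | h m t =>
      obtain ⟨m, rfl⟩ := Ideal.Quotient.mk_surjective m
      rw [algebraMap_smul, LocalizedModule.smul'_mk]
      have : s' • Ideal.Quotient.mk I m = 0 :=
        Ideal.Quotient.eq_zero_iff_mem.2 (I.mul_mem_right _ hsI)
      rw [this, LocalizedModule.zero_mk]
  let b := Module.Free.chooseBasis (Localization.AtPrime p) (LocalizedModule p.primeCompl (A ⧸ I))
  obtain ⟨i⟩ := b.index_nonempty
  have h7 := DFunLike.congr_fun (congrArg b.repr (h6 (b i))) i
  rw [map_smul] at h7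
  simpa [Algebra.algebraMap_eq_smul_one] using h7

end Rank

section Avoidance

variable {R : Type*} [CommRing R] {I : Ideal R}

theorem exists_forall_mul_notMem_mul (hI : I.FG) {f : R} (hf : f ∈ I) (hf' : f ∈ nonZeroDivisors R)
    (p : Ideal R) [p.IsPrime] : ∃ x ∈ I, ∀ s ∉ p, s * x ∉ p * I := by
  by_contra! hc
  let B := Localization.AtPrime p
  have hle : I.map (algebraMap R B) ≤ IsLocalRing.maximalIdeal B • I.map (algebraMap R B) := by
    refine Ideal.map_le_iff_le_comap.2 fun x hx => ?_
    obtain ⟨s, hs, hsx⟩ := hc x hx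
    have h1 : algebraMap R B (s * x) ∈ (p * I).map (algebraMap R B) := Ideal.mem_map_of_mem _ hsx
    rw [Ideal.map_mul, Localization.AtPrime.map_eq_maximalIdeal, map_mul] at h1
    exact (Ideal.unit_mul_mem_iff_mem _
      (IsLocalization.map_units B (⟨s, hs⟩ : p.primeCompl))).1 h1
  have h0 := Submodule.eq_bot_of_le_smul_of_le_jacobson_bot _ (I.map (algebraMap R B)) (Ideal.FG.map hI _) hle
    (IsLocalRing.maximalIdeal_le_jacobson _)
  have h1 : algebraMap R B f = 0 := by
    rw [← Ideal.mem_bot, ← h0]; exact Ideal.mem_map_of_mem _ hf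
  obtain ⟨⟨s, hs⟩, h2⟩ := (IsLocalization.map_eq_zero_iff p.primeCompl B f).1 h1
  have h3 : s = 0 := (mem_nonZeroDivisors_iff_right.1 hf') s h2
  exact hs (h3 ▸ p.zero_mem)

theorem exists_mem_forall_mul_notMem_mul (T : Finset (Ideal R)) (hPT : ∀ p ∈ T, p.IsPrime)
    (h : ∀ p ∈ T, ∃ x ∈ I, ∀ s ∉ p, s * x ∉ p * I) :
    ∃ x ∈ I, ∀ p ∈ T, ∀ s ∉ p, s * x ∉ p * I := by
  classical
  induction T using Finset.strongInduction with
  | H T ih =>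
    rcases T.eq_empty_or_nonempty with rfl | hne
    · exact ⟨0, I.zero_mem, by simp⟩
    obtain ⟨p, hp, hmin⟩ := T.exists_minimal hne
    obtain ⟨x, hx, hx'⟩ := ih (T.erase p) (Finset.erase_ssubset hp)
      (fun q hq => hPT q (Finset.mem_of_mem_erase hq))
      (fun q hq => h q (Finset.mem_of_mem_erase hq))
    have := hPT p hp
    by_cases hxp : ∀ s ∉ p, s * x ∉ p * I
    · refine ⟨x, hx, fun q hq => ?_⟩
      by_cases hqp : q = p
      · exact hqp ▸ hxp
      · exact hx' q (Finset.mem_erase.2 ⟨hqp, hq⟩)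
    push Not at hxp
    obtain ⟨s, hs, hsx⟩ := hxp
    obtain ⟨y, hy, hy'⟩ := h p hp
    obtain ⟨a, ha, hap⟩ : ∃ a ∈ ∏ q ∈ T.erase p, q, a ∉ p := by
      rw [← SetLike.not_le_iff_exists, Ideal.IsPrime.prod_le this]
      rintro ⟨q, hq, hqp⟩
      exact (Finset.mem_erase.1 hq).1 (le_antisymm hqp (hmin (Finset.mem_of_mem_erase hq) hqp))
    refine ⟨x + a * y, I.add_mem hx (I.mul_mem_left _ hy), fun q hq t ht hmem => ?_⟩
    by_cases hqp : q = p
    · subst hqp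
      refine hy' (s * t * a) (fun h' => ?_) ?_
      · rcases this.mem_or_mem h' with h' | h'
        · exact (this.mem_or_mem h').elim hs ht
        · exact hap h'
      · have := sub_mem ((q * I).mul_mem_left s hmem) ((q * I).mul_mem_left t hsx)
        convert this using 1
        ring
    · have hq' := Finset.mem_erase.2 ⟨hqp, hq⟩
      refine hx' q hq' t ht ?_
      have haq : a ∈ q := (Ideal.prod_le_inf.trans (Finset.inf_le hq')) ha
      have := sub_mem hmem ((q * I).mul_mem_left t (Ideal.mul_mem_mul haq hy))
      convert this using 1
      ring

theorem exists_regular_forall_mul_notMem_mul [IsLocalRing R] [IsNoetherianRing R] {f : R}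
    (hf : f ∈ I) (hf' : f ∈ nonZeroDivisors R) {Q : Set (Ideal R)} (hQf : Q.Finite)
    (hp : ∀ p ∈ Q, p.IsPrime) :
    ∃ x ∈ I, x ∈ nonZeroDivisors R ∧ x ∉ IsLocalRing.maximalIdeal R * I ∧
      ∀ p ∈ Q, ∀ s ∉ p, s * x ∉ p * I := by
  classical
  let T : Finset (Ideal R) := insert (IsLocalRing.maximalIdeal R)
    ((associatedPrimes.finite R R).toFinset ∪ hQf.toFinset)
  have hPT : ∀ p ∈ T, p.IsPrime := fun p h => by
    simp only [T, Finset.mem_insert, Finset.mem_union, Set.Finite.mem_toFinset] at h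
    rcases h with rfl | h | h
    · infer_instance
    · exact h.1
    · exact hp p h
  obtain ⟨x, hx, h⟩ := exists_mem_forall_mul_notMem_mul T hPT fun p hp =>
    have := hPT p hp
    exists_forall_mul_notMem_mul (IsNoetherian.noetherian I) hf hf' p
  refine ⟨x, hx, ?_, ?_, fun p hp => h p (by simp [T, hp])⟩
  · by_contra hc
    have hc' : x ∈ ((nonZeroDivisors R : Set R))ᶜ := hc
    rw [← biUnion_associatedPrimes_eq_compl_nonZeroDivisors, Set.mem_iUnion₂] at hc'
    obtain ⟨q, hq, hxq⟩ := hc'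
    have hfq : f ∉ q := fun hfq => by
      have h1 : f ∈ ((nonZeroDivisors R : Set R))ᶜ := by
        rw [← biUnion_associatedPrimes_eq_compl_nonZeroDivisors]
        exact Set.mem_iUnion₂.2 ⟨q, hq, hfq⟩
      exact h1 hf'
    exact h q (by simp [T, hq]) f hfq (mul_comm x f ▸ Ideal.mul_mem_mul hxq hf)
  · have := h (IsLocalRing.maximalIdeal R) (by simp [T]) 1
      (fun h => (IsLocalRing.mem_maximalIdeal _).1 h isUnit_one)
    rwa [one_mul] at this

end Avoidance

section Step

variable {R : Type u} [CommRing R] {I : Ideal R} {S : Type u} [CommRing S] [Algebra R S]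
  {M : Type u} [AddCommGroup M] [Module S M]

theorem mul_algebraMap_iff {B : Type u} [CommRing B] [Algebra R B] [Algebra B S]
    [IsScalarTower R B S] (hB : Function.Surjective (algebraMap R B)) {f : R} (hfI : f ∈ I)
    (hkB : ∀ a : R, algebraMap R B a = 0 ↔ f ∣ a)
    (hker : ∀ a : R, algebraMap R S a = 0 ↔ a ∈ I) (b : B) :
    algebraMap B S b = 0 ↔ b ∈ I.map (algebraMap R B) := by
  obtain ⟨a, rfl⟩ := hB b
  rw [← IsScalarTower.algebraMap_apply, hker]
  refine ⟨fun h => Ideal.mem_map_of_mem _ h, fun h => ?_⟩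
  obtain ⟨x, hx, hxa⟩ := (Ideal.mem_map_iff_of_surjective _ hB).1 h
  obtain ⟨r, hr⟩ := (hkB (x - a)).1 (by rw [map_sub, hxa, sub_self])
  rw [← sub_sub_cancel x a, hr]
  exact I.sub_mem hx (I.mul_mem_right _ hfI)

theorem exists_map_quotient (hS : Function.Surjective (algebraMap R S)) (π : I →+ M)
    (hπ : ∀ (a : R) (x : I), π (a • x) = algebraMap R S a • π x)
    (hπs : Function.Surjective π) (hπk : ∀ x : I, π x = 0 ↔ (x : R) ∈ I ^ 2)
    {B : Type u} [CommRing B] [Algebra R B] [Algebra B S]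
    [IsScalarTower R B S] (hB : Function.Surjective (algebraMap R B)) (f : I)
    (hkB : ∀ a : R, algebraMap R B a = 0 ↔ (f : R) ∣ a) :
    ∃ π' : I.map (algebraMap R B) →+ M ⧸ Submodule.span S {π f},
      (∀ (b : B) (x : I.map (algebraMap R B)), π' (b • x) = algebraMap B S b • π' x) ∧
      Function.Surjective π' ∧
      ∀ x : I.map (algebraMap R B), π' x = 0 ↔ (x : B) ∈ (I.map (algebraMap R B)) ^ 2 := by
  let q := (Submodule.span S {π f}).mkQ
  have key : ∀ x y : I, algebraMap R B x = algebraMap R B y → q (π x) = q (π y) := by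
    intro x y h
    obtain ⟨r, hr⟩ := (hkB (x - y)).1 (by rw [map_sub, h, sub_self])
    have : x = y + r • f := Subtype.ext (by
      change (x : R) = y + r * f
      rw [mul_comm, ← hr]; ring)
    rw [this, map_add, hπ, map_add, map_smul]
    have : q (π f) = 0 := (Submodule.Quotient.mk_eq_zero _).2 (Submodule.mem_span_singleton_self _)
    rw [this, smul_zero, add_zero]
  have hl : ∀ y : I.map (algebraMap R B), ∃ x : I, algebraMap R B x = y := fun y => by
    obtain ⟨x, hx, hxy⟩ := (Ideal.mem_map_iff_of_surjective _ hB).1 y.2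
    exact ⟨⟨x, hx⟩, hxy⟩
  choose l hl using hl
  let π' : I.map (algebraMap R B) →+ M ⧸ Submodule.span S {π f} :=
    AddMonoidHom.mk' (fun y => q (π (l y))) fun x y => by
      rw [← map_add, ← map_add]
      refine key _ _ ?_
      rw [hl, Submodule.coe_add, Submodule.coe_add, map_add, hl, hl]
  have hπ' : ∀ y, π' y = q (π (l y)) := fun _ => rfl
  refine ⟨π', fun b x => ?_, fun z => ?_, fun x => ?_⟩
  · obtain ⟨a, rfl⟩ := hB b
    rw [hπ', hπ', ← IsScalarTower.algebraMap_apply, ← map_smul, ← hπ]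
    refine key _ _ ?_
    rw [hl]
    change _ * (x : B) = algebraMap R B (a * l x)
    rw [map_mul, hl]
  · obtain ⟨z, rfl⟩ := Submodule.mkQ_surjective _ z
    obtain ⟨x, rfl⟩ := hπs z
    exact ⟨⟨algebraMap R B x, Ideal.mem_map_of_mem _ x.2⟩, key _ _ (hl _)⟩
  · rw [hπ', ← Ideal.map_pow]
    constructor
    · intro h
      obtain ⟨s, hs⟩ := Submodule.mem_span_singleton.1 ((Submodule.Quotient.mk_eq_zero _).1 h)
      obtain ⟨r, rfl⟩ := hS s
      have h1 : π (l x - r • f) = 0 := by rw [map_sub, hπ, hs, sub_self]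
      rw [hπk] at h1
      have h2 := Ideal.mem_map_of_mem (algebraMap R B) h1
      have h3 : algebraMap R B ((l x - r • f : I) : R) = x := by
        change algebraMap R B (l x - r * f) = x
        rw [map_sub, hl, map_mul, (hkB f).2 dvd_rfl, mul_zero, sub_zero]
      rwa [h3] at h2
    · intro h
      obtain ⟨y, hy, hyx⟩ := (Ideal.mem_map_iff_of_surjective _ hB).1 h
      have h1 := key (l x) ⟨y, Ideal.pow_le_self two_ne_zero hy⟩ ((hl x).trans hyx.symm)
      exact h1.trans ((congrArg q ((hπk _).2 hy)).trans (map_zero q))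

theorem PdLT.quotient_span_singleton {n : ℕ} (h : PdLT S M n) {x : M}
    (hx : ∀ a : S, a • x = 0 → a = 0) : PdLT S (M ⧸ Submodule.span S {x}) (n + 2) := by
  refine PdLT.of_ker (Submodule.mkQ_surjective (Submodule.span S {x})) ?_ (h.mono (by omega))
  have hinj : Function.Injective (LinearMap.toSpanSingleton S M x) :=
    (injective_iff_map_eq_zero _).2 fun a ha => hx a ha
  exact PdLT.of_equiv (N := S) PdLT.of_projective
    ((LinearEquiv.ofInjective _ hinj).trans (LinearEquiv.ofEq _ _ (by
      rw [Submodule.ker_mkQ, LinearMap.range_toSpanSingleton])))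

theorem exists_eq_span_singleton_sup [IsLocalRing R] {c : ℕ} {g : Fin (c + 1) → R} {f : R}
    (hI : I = Ideal.span (Set.range g)) (hf : f ∈ I)
    (hf' : f ∉ IsLocalRing.maximalIdeal R * I) :
    ∃ g' : Fin c → R, I = Ideal.span {f} ⊔ Ideal.span (Set.range g') := by
  subst hI
  obtain ⟨a, rfl⟩ := (Ideal.mem_span_range_iff_exists_fun).1 hf
  obtain ⟨i, hi⟩ : ∃ i, IsUnit (a i) := by
    by_contra! h
    exact hf' (sum_mem fun i _ => Ideal.mul_mem_mul (h i) (Ideal.subset_span ⟨i, rfl⟩))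
  refine ⟨fun j => g (i.succAbove j), le_antisymm (Ideal.span_le.2 ?_) (sup_le ?_ ?_)⟩
  · have hle : Ideal.span (Set.range fun j => g (i.succAbove j)) ≤
      Ideal.span {∑ i, a i * g i} ⊔ Ideal.span (Set.range fun j => g (i.succAbove j)) := le_sup_right
    rintro _ ⟨j, rfl⟩
    rcases Fin.eq_self_or_eq_succAbove i j with rfl | ⟨j, rfl⟩
    · refine (Ideal.unit_mul_mem_iff_mem _ hi).1 ?_
      have h1 := Fin.sum_univ_succAbove (fun i => a i * g i) j
      rw [eq_comm, ← eq_sub_iff_add_eq] at h1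
      rw [h1]
      refine sub_mem (Ideal.mem_sup_left (Ideal.subset_span rfl)) (sum_mem fun k _ => ?_)
      exact Ideal.mul_mem_left _ _ (hle (Ideal.subset_span ⟨k, rfl⟩))
    · exact hle (Ideal.subset_span ⟨j, rfl⟩)
  · rwa [Ideal.span_le, Set.singleton_subset_iff]
  · refine Ideal.span_mono ?_
    rintro _ ⟨j, rfl⟩
    exact ⟨_, rfl⟩

/-- An element of `I` that is regular, and whose image in `I / I ^ 2` is a minimal generator
spanning a free submodule. -/
theorem exists_good_element [IsLocalRing R] [IsNoetherianRing R] [Nontrivial S]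
    (hS : Function.Surjective (algebraMap R S))
    (hker : ∀ a : R, algebraMap R S a = 0 ↔ a ∈ I) (π : I →+ M)
    (hπ : ∀ (a : R) (x : I), π (a • x) = algebraMap R S a • π x)
    (hπs : Function.Surjective π) (hπk : ∀ x : I, π x = 0 ↔ (x : R) ∈ I ^ 2)
    (hI0 : I ≠ ⊥) {n : ℕ} (hpd : PdLT R S n) :
    ∃ f : I, (f : R) ∈ nonZeroDivisors R ∧ (f : R) ∉ IsLocalRing.maximalIdeal R * I ∧
      (∀ p : Ideal S, p.IsPrime → p ∈ associatedPrimes S S ∨ p.IsMaximal →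
        ∀ t ∉ p, t • π f ∉ p • (⊤ : Submodule S M)) := by
  have e : S ≃ₗ[R] (R ⧸ I) := ((Submodule.quotEquivOfEq _ _ (Ideal.ext fun a =>
    (hker a).symm)).trans (LinearMap.quotKerEquivOfSurjective (Algebra.linearMap R S) hS)).symm
  obtain ⟨f, hf, hf'⟩ := exists_nonZeroDivisor_mem hI0 (hpd.of_equiv e)
  have : IsNoetherianRing S := isNoetherianRing_of_surjective _ _ _ hS
  have hQ : ((associatedPrimes S S).image (Ideal.comap (algebraMap R S))).Finite :=
    (associatedPrimes.finite S S).image _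
  obtain ⟨x, hx, hx1, hx2, hx3⟩ := exists_regular_forall_mul_notMem_mul hf hf' hQ (by
    rintro _ ⟨p, hp, rfl⟩
    have := hp.1
    infer_instance)
  have hlift : ∀ (p : Ideal S) (z : M), z ∈ p • (⊤ : Submodule S M) →
      ∃ y : I, (y : R) ∈ p.comap (algebraMap R S) * I ∧ π y = z := by
    intro p z hz
    induction hz using Submodule.smul_induction_on' with
    | smul r hr w _ =>
      obtain ⟨a, rfl⟩ := hS r
      obtain ⟨y, rfl⟩ := hπs w
      exact ⟨a • y, Ideal.mul_mem_mul hr y.2, hπ a y⟩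
    | add z _ w _ h1 h2 =>
      obtain ⟨y, hy, rfl⟩ := h1
      obtain ⟨y', hy', rfl⟩ := h2
      exact ⟨y + y', add_mem hy hy', map_add _ _ _⟩
  have key : ∀ (p : Ideal S) (a : R), algebraMap R S a • π ⟨x, hx⟩ ∈ p • (⊤ : Submodule S M) →
      a * x ∈ p.comap (algebraMap R S) * I := by
    intro p a h
    obtain ⟨y, hy, hyx⟩ := hlift p _ h
    rw [← hπ] at hyx
    have h1 : π (a • ⟨x, hx⟩ - y) = 0 := by rw [map_sub, hyx, sub_self]
    rw [hπk] at h1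
    have h2 : I ^ 2 ≤ p.comap (algebraMap R S) * I := by
      rw [pow_two]
      refine Ideal.mul_mono_left fun b hb => ?_
      rw [Ideal.mem_comap, (hker b).2 hb]
      exact p.zero_mem
    have h3 := add_mem (h2 h1) hy
    convert h3 using 1
    change a * x = a * x - y + y
    ring
  refine ⟨⟨x, hx⟩, hx1, hx2, fun p hp hpm t ht h => ?_⟩
  obtain ⟨a, rfl⟩ := hS t
  rcases hpm with hpm | hpm
  · exact hx3 _ ⟨p, hpm, rfl⟩ a ht (key p a h)
  · have : (p.comap (algebraMap R S)).IsMaximal := Ideal.comap_isMaximal_of_surjective _ hS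
    have h1 := key p a h
    rw [IsLocalRing.eq_maximalIdeal this] at h1
    have h2 : IsUnit a := by
      by_contra h3
      have h4 : a ∈ p.comap (algebraMap R S) := IsLocalRing.eq_maximalIdeal this ▸ h3
      exact ht h4
    exact hx2 ((Ideal.unit_mul_mem_iff_mem _ h2).1 h1)

end Step

section Main

theorem isWeaklyRegular_cons_of_quotient {R : Type*} [CommRing R] {f : R} {rs : List R}
    (hf : f ∈ nonZeroDivisors R)
    (h : RingTheory.Sequence.IsWeaklyRegular (R ⧸ Ideal.span {f})
      (rs.map (algebraMap R (R ⧸ Ideal.span {f})))) :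
    RingTheory.Sequence.IsWeaklyRegular R (f :: rs) := by
  rw [RingTheory.Sequence.isWeaklyRegular_cons_iff]
  refine ⟨fun a b hab => mul_cancel_left_mem_nonZeroDivisors hf |>.1 hab, ?_⟩
  rw [RingTheory.Sequence.isWeaklyRegular_map_algebraMap_iff] at h
  have e : QuotSMulTop f R ≃ₗ[R] (R ⧸ Ideal.span {f}) :=
    Submodule.quotEquivOfEq _ _ (by
      rw [← Submodule.ideal_span_singleton_smul, smul_eq_mul, Ideal.mul_top])
  exact (e.isWeaklyRegular_congr rs).2 h

theorem exists_isWeaklyRegular_of_pdLT {S : Type u} [CommRing S] [Nontrivial S] (c : ℕ) :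
    ∀ (R : Type u) [CommRing R] [IsLocalRing R] [IsNoetherianRing R] [Algebra R S] (I : Ideal R)
    (_ : Function.Surjective (algebraMap R S)) (_ : ∀ a : R, algebraMap R S a = 0 ↔ a ∈ I)
    (M : Type u) [AddCommGroup M] [Module S M] (π : I →+ M)
    (_ : ∀ (a : R) (x : I), π (a • x) = algebraMap R S a • π x)
    (_ : Function.Surjective π) (_ : ∀ x : I, π x = 0 ↔ (x : R) ∈ I ^ 2)
    (n m : ℕ) (_ : PdLT R S n) (_ : PdLT S M m)
    (g : Fin c → R) (_ : I = Ideal.span (Set.range g)),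
    ∃ rs : List R, RingTheory.Sequence.IsWeaklyRegular R rs ∧ Ideal.span {x | x ∈ rs} = I := by
  induction c with
  | zero =>
    intro R _ _ _ _ I hS hker M _ _ π hπ hπs hπk n m hpd hpd' g hg
    refine ⟨[], .nil R R, ?_⟩
    rw [hg]
    simp
  | succ c ih =>
    intro R _ _ _ _ I hS hker M _ _ π hπ hπs hπk n m hpd hpd' g hg
    by_cases hI0 : I = ⊥
    · exact ⟨[], .nil R R, by simp [hI0]⟩
    have : IsNoetherianRing S := isNoetherianRing_of_surjective _ _ _ hS
    have : IsLocalRing S := IsLocalRing.of_surjective' _ hS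
    have hIm : I ≤ IsLocalRing.maximalIdeal R := IsLocalRing.le_maximalIdeal fun h =>
      one_ne_zero (α := S) (by rw [← map_one (algebraMap R S), hker, h]; trivial)
    have : RingHomSurjective (algebraMap R S) := ⟨hS⟩
    let π₁ : I →ₛₗ[algebraMap R S] M := { toFun := π, map_add' := map_add π, map_smul' := hπ }
    have : Module.Finite S M := Module.Finite.of_surjective π₁ hπs
    obtain ⟨f, hf, hf', hfp⟩ := exists_good_element hS hker π hπ hπs hπk hI0 hpd
    have hfS : π f ∉ IsLocalRing.maximalIdeal S • (⊤ : Submodule S M) := by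
      simpa using hfp (IsLocalRing.maximalIdeal S) inferInstance (.inr inferInstance) 1
        (fun h => (IsLocalRing.mem_maximalIdeal _).1 h isUnit_one)
    have hfr : ∀ a : S, a • π f = 0 → a = 0 := fun a ha =>
      hpd'.eq_zero_of_smul_eq_zero (fun p s hp hs t ht => hfp p hp (.inl
        (isAssociatedPrime_iff.2 ⟨hp, s, Ideal.ext fun a => by
          rw [hs, Submodule.mem_colon_singleton, Submodule.mem_bot]; rfl⟩)) t ht) ha
    obtain ⟨Q, e, he, hQe, hQm⟩ := hpd'.exists_fRes hfS
    obtain ⟨P, hP, hPe⟩ := exists_res (m := IsLocalRing.maximalIdeal R)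
      hS hker π hπ hπs hπk Q e he f hQe fun c a ha h => by
        have h1 : IsUnit (algebraMap R S a) := IsUnit.map _ h
        rw [ha] at h1
        exact (IsLocalRing.mem_maximalIdeal _).1 (hQm c) h1
    let B := R ⧸ Ideal.span {(f : R)}
    have hB : Function.Surjective (algebraMap R B) := Ideal.Quotient.mk_surjective
    have hkB : ∀ a : R, algebraMap R B a = 0 ↔ (f : R) ∣ a := fun a => by
      rw [Ideal.Quotient.algebraMap_eq, Ideal.Quotient.eq_zero_iff_mem, Ideal.mem_span_singleton]
    let φ : B →+* S := Ideal.Quotient.lift _ (algebraMap R S) fun a ha => by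
      obtain ⟨r, rfl⟩ := Ideal.mem_span_singleton.1 ha
      rw [hker]
      exact I.mul_mem_right _ f.2
    let _ : Algebra B S := φ.toAlgebra
    have : IsScalarTower R B S := IsScalarTower.of_algebraMap_eq fun a => rfl
    have hBS : Function.Surjective (algebraMap B S) := fun s => by
      obtain ⟨a, rfl⟩ := hS s
      exact ⟨algebraMap R B a, rfl⟩
    have : Nontrivial B := (algebraMap B S).domain_nontrivial
    have : IsLocalRing B := IsLocalRing.of_surjective' _ hB
    have hpdB : PdLT B S (n + 1) := pdLT_of_res hf (hIm f.2) hS hker (hpd.mono (by omega)) hP hPe f.2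
      hB hkB
    obtain ⟨π', h1, h2, h3⟩ := exists_map_quotient hS π hπ hπs hπk hB f hkB
    obtain ⟨g', hg'⟩ := exists_eq_span_singleton_sup hg f.2 hf'
    obtain ⟨rs, hrs, hrsI⟩ := ih B (I.map (algebraMap R B)) hBS
      (mul_algebraMap_iff hB f.2 hkB hker) _ π' h1 h2 h3 _ _ hpdB
      (hpd'.quotient_span_singleton hfr) (fun i => algebraMap R B (g' i)) (by
        refine (congrArg (Ideal.map (algebraMap R B)) hg').trans ?_
        rw [Ideal.map_sup, Ideal.map_span, Ideal.map_span, Set.image_singleton,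
          (hkB f).2 dvd_rfl, ← Set.range_comp]
        simp [Function.comp_def])
    obtain ⟨rs, rfl⟩ := List.map_surjective_iff.2 hB rs
    refine ⟨(f : R) :: rs, isWeaklyRegular_cons_of_quotient hf hrs, ?_⟩
    have h4 : Ideal.ofList ((f : R) :: rs) = I := by
      have h5 : (Ideal.ofList rs).map (algebraMap R B) = I.map (algebraMap R B) := by
        rw [Ideal.map_ofList]; exact hrsI
      have h6 : RingHom.ker (algebraMap R B) = Ideal.span {(f : R)} := Ideal.mk_ker
      rw [Ideal.ofList_cons, sup_comm]
      have h7 := congrArg (Ideal.comap (algebraMap R B)) h5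
      rw [Ideal.comap_map_of_surjective _ hB, Ideal.comap_map_of_surjective _ hB,
        ← RingHom.ker_eq_comap_bot, h6] at h7
      rw [h7, sup_eq_left, Ideal.span_le, Set.singleton_subset_iff]
      exact f.2
    exact h4

end Main

theorem hasProjectiveDimensionLT_of_hasProjDimLE {R : Type u} [CommRing R] {M : ModuleCat.{u} R}
    {n : ℕ} (h : ModuleCat.HasProjDimLE R M n) : HasProjectiveDimensionLT M (n + 1) := by
  obtain ⟨P, π, hπ, hP, h0⟩ := h
  let Q : ProjectiveResolution M := { complex := P, projective := hP, π := π, quasiIso := hπ }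
  rw [hasProjectiveDimensionLT_iff.{u}]
  intro i hi Y e
  obtain ⟨f, hf, rfl⟩ := Q.extMk_surjective e _ rfl
  obtain rfl : f = 0 := (h0 i hi).eq_of_src _ _
  simp

end Vasconcelos

/-- **Vasconcelos' conjecture.** -/
theorem vasconcelos_conormal_module (R : Type u) [CommRing R] [IsLocalRing R]
    [IsNoetherianRing R] (I : Ideal R) (hI : I ≠ ⊤)
    (hpdS : ∃ n, ModuleCat.HasProjDimLE R (ModuleCat.of R (R ⧸ I)) n)
    (hpdC : ∃ n, ModuleCat.HasProjDimLE (R ⧸ I) (ModuleCat.of (R ⧸ I) I.Cotangent) n) :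
    ∃ rs : List R, RingTheory.Sequence.IsRegular R rs ∧ Ideal.span {x | x ∈ rs} = I := by
  obtain ⟨n, hn⟩ := hpdS
  obtain ⟨m, hm⟩ := hpdC
  have : Nontrivial (R ⧸ I) := Ideal.Quotient.nontrivial_iff.2 hI
  obtain ⟨c, g, hg⟩ := Submodule.fg_iff_exists_fin_generating_family.1
    (IsNoetherian.noetherian I)
  obtain ⟨rs, hrs, hrsI⟩ := Vasconcelos.exists_isWeaklyRegular_of_pdLT (S := R ⧸ I) c R I
    Ideal.Quotient.mk_surjective (fun a => Ideal.Quotient.eq_zero_iff_mem) I.Cotangent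
    I.toCotangent.toAddMonoidHom (fun a x => I.toCotangent.map_smul a x)
    I.toCotangent_surjective (fun x => I.toCotangent_eq_zero x) _ _
    (Vasconcelos.hasProjectiveDimensionLT_of_hasProjDimLE hn)
    (Vasconcelos.hasProjectiveDimensionLT_of_hasProjDimLE hm) g hg.symm
  refine ⟨rs, ⟨hrs, fun h => hI ?_⟩, hrsI⟩
  have h1 : Ideal.ofList rs = I := hrsI
  rw [h1, smul_eq_mul, Ideal.mul_top] at h
  exact h.symm
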